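/- arXiv:1507.08714 — 9 statements merged into one kernel-verified Lean document; each statement's English description precedes it below -/
import Mathlib

section
/- Let 2 ≤ p < ∞, let Ω ⊂ ℝⁿ (n ≥ 2) be a bounded domain and T > 0. Let u be upper semicontinuous on Ω_T ∪ P_T and a viscosity subsolution of G_p u = 0 in Ω_T, and let v be lower semicontinuous on Ω_T ∪ P_T and a viscosity supersolution of G_p v = 0 in Ω_T. If u and v are bounded and u ≤ v on P_T, then u ≤ v in Ω_T. -/
open Set Filter
open scoped Classical

/-- The p-Laplacian of a C² test function, in the form used in viscosity solution theory:
`Δ_p φ = |Dφ|^{p-2} tr(D²φ) + (p-2)|Dφ|^{p-4} ⟨D²φ Dφ, Dφ⟩`, set to `0` when `Dφ = 0` and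
`p ≠ 2`, and to `tr(D²φ)` when `p = 2`. -/
noncomputable def pLap (n : ℕ) (p : ℝ) (φ : EuclideanSpace ℝ (Fin n) → ℝ)
    (x : EuclideanSpace ℝ (Fin n)) : ℝ :=
  if gradient φ x = 0 then
    if p = 2 then
      ∑ i : Fin n, iteratedFDeriv ℝ 2 φ x
        ![EuclideanSpace.single i (1 : ℝ), EuclideanSpace.single i (1 : ℝ)]
    else 0
  else
    ‖gradient φ x‖ ^ (p - 2) *
        ∑ i : Fin n, iteratedFDeriv ℝ 2 φ x
          ![EuclideanSpace.single i (1 : ℝ), EuclideanSpace.single i (1 : ℝ)] +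
      (p - 2) * ‖gradient φ x‖ ^ (p - 4) *
        iteratedFDeriv ℝ 2 φ x ![gradient φ x, gradient φ x]

/-- The infinity-Laplacian `Δ_∞ φ = ⟨D²φ Dφ, Dφ⟩` of a C² test function. -/
noncomputable def infLap (n : ℕ) (φ : EuclideanSpace ℝ (Fin n) → ℝ)
    (x : EuclideanSpace ℝ (Fin n)) : ℝ :=
  iteratedFDeriv ℝ 2 φ x ![gradient φ x, gradient φ x]

/-- Parabolic test functions: C² in the space variable and C¹ in the time variable. -/
def ParaTestFn (n : ℕ) (ψ : EuclideanSpace ℝ (Fin n) × ℝ → ℝ) : Prop :=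
  (∀ t : ℝ, ContDiff ℝ 2 fun x => ψ (x, t)) ∧ ∀ x, ContDiff ℝ 1 fun t => ψ (x, t)

/-- The p-Laplacian in the space variable of a parabolic test function. -/
noncomputable def pSpaceLap (n : ℕ) (p : ℝ) (ψ : EuclideanSpace ℝ (Fin n) × ℝ → ℝ)
    (q : EuclideanSpace ℝ (Fin n) × ℝ) : ℝ :=
  pLap n p (fun x => ψ (x, q.2)) q.1

/-- The time derivative `ψ_t` of a parabolic test function. -/
noncomputable def timeDeriv (n : ℕ) (ψ : EuclideanSpace ℝ (Fin n) × ℝ → ℝ)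
    (q : EuclideanSpace ℝ (Fin n) × ℝ) : ℝ :=
  deriv (fun t => ψ (q.1, t)) q.2

/-- Viscosity subsolution of Trudinger's equation `Γ_p u = Δ_p u − (p−1)u^{p−2}u_t = 0` on `U`. -/
def TrudSub (n : ℕ) (p : ℝ) (U : Set (EuclideanSpace ℝ (Fin n) × ℝ))
    (u : EuclideanSpace ℝ (Fin n) × ℝ → ℝ) : Prop :=
  ∀ ψ, ParaTestFn n ψ → ∀ q ∈ U, IsLocalMaxOn (fun z => u z - ψ z) U q →
    0 ≤ pSpaceLap n p ψ q - (p - 1) * u q ^ (p - 2) * timeDeriv n ψ q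

/-- Viscosity supersolution of Trudinger's equation `Γ_p u = 0` on `U`. -/
def TrudSuper (n : ℕ) (p : ℝ) (U : Set (EuclideanSpace ℝ (Fin n) × ℝ))
    (u : EuclideanSpace ℝ (Fin n) × ℝ → ℝ) : Prop :=
  ∀ ψ, ParaTestFn n ψ → ∀ q ∈ U, IsLocalMinOn (fun z => u z - ψ z) U q →
    pSpaceLap n p ψ q - (p - 1) * u q ^ (p - 2) * timeDeriv n ψ q ≤ 0

/-- Viscosity subsolution of `Δ_p u − (p−1)|u|^{p−2}u_t = 0` on `U`. -/
def TrudAbsSub (n : ℕ) (p : ℝ) (U : Set (EuclideanSpace ℝ (Fin n) × ℝ))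
    (u : EuclideanSpace ℝ (Fin n) × ℝ → ℝ) : Prop :=
  ∀ ψ, ParaTestFn n ψ → ∀ q ∈ U, IsLocalMaxOn (fun z => u z - ψ z) U q →
    0 ≤ pSpaceLap n p ψ q - (p - 1) * |u q| ^ (p - 2) * timeDeriv n ψ q

/-- Viscosity subsolution of `G_p w = Δ_p w + (p−1)|Dw|^p − (p−1)w_t = 0` on `U`. -/
def GpSub (n : ℕ) (p : ℝ) (U : Set (EuclideanSpace ℝ (Fin n) × ℝ))
    (w : EuclideanSpace ℝ (Fin n) × ℝ → ℝ) : Prop :=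
  ∀ ψ, ParaTestFn n ψ → ∀ q ∈ U, IsLocalMaxOn (fun z => w z - ψ z) U q →
    0 ≤ pSpaceLap n p ψ q + (p - 1) * ‖gradient (fun x => ψ (x, q.2)) q.1‖ ^ p -
        (p - 1) * timeDeriv n ψ q

/-- Viscosity supersolution of `G_p w = 0` on `U`. -/
def GpSuper (n : ℕ) (p : ℝ) (U : Set (EuclideanSpace ℝ (Fin n) × ℝ))
    (w : EuclideanSpace ℝ (Fin n) × ℝ → ℝ) : Prop :=
  ∀ ψ, ParaTestFn n ψ → ∀ q ∈ U, IsLocalMinOn (fun z => w z - ψ z) U q →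
    pSpaceLap n p ψ q + (p - 1) * ‖gradient (fun x => ψ (x, q.2)) q.1‖ ^ p -
        (p - 1) * timeDeriv n ψ q ≤ 0

/-- Viscosity subsolution of `Γ_∞ u = Δ_∞ u − 3u²u_t = 0` on `U`. -/
def GammaInfSub (n : ℕ) (U : Set (EuclideanSpace ℝ (Fin n) × ℝ))
    (u : EuclideanSpace ℝ (Fin n) × ℝ → ℝ) : Prop :=
  ∀ ψ, ParaTestFn n ψ → ∀ q ∈ U, IsLocalMaxOn (fun z => u z - ψ z) U q →
    0 ≤ infLap n (fun x => ψ (x, q.2)) q.1 - 3 * u q ^ 2 * timeDeriv n ψ q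

/-- Viscosity supersolution of `Γ_∞ u = 0` on `U`. -/
def GammaInfSuper (n : ℕ) (U : Set (EuclideanSpace ℝ (Fin n) × ℝ))
    (u : EuclideanSpace ℝ (Fin n) × ℝ → ℝ) : Prop :=
  ∀ ψ, ParaTestFn n ψ → ∀ q ∈ U, IsLocalMinOn (fun z => u z - ψ z) U q →
    infLap n (fun x => ψ (x, q.2)) q.1 - 3 * u q ^ 2 * timeDeriv n ψ q ≤ 0

/-- Viscosity subsolution of the elliptic equation `Δ_p u + f(x, u) = 0` on `Ω`. -/
def PLapFSub (n : ℕ) (p : ℝ) (f : EuclideanSpace ℝ (Fin n) → ℝ → ℝ)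
    (Ω : Set (EuclideanSpace ℝ (Fin n))) (u : EuclideanSpace ℝ (Fin n) → ℝ) : Prop :=
  ∀ φ, ContDiff ℝ 2 φ → ∀ y ∈ Ω, IsLocalMaxOn (fun x => u x - φ x) Ω y →
    0 ≤ pLap n p φ y + f y (u y)

/-- Viscosity supersolution of the elliptic equation `Δ_p u + f(x, u) = 0` on `Ω`. -/
def PLapFSuper (n : ℕ) (p : ℝ) (f : EuclideanSpace ℝ (Fin n) → ℝ → ℝ)
    (Ω : Set (EuclideanSpace ℝ (Fin n))) (u : EuclideanSpace ℝ (Fin n) → ℝ) : Prop :=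
  ∀ φ, ContDiff ℝ 2 φ → ∀ y ∈ Ω, IsLocalMinOn (fun x => u x - φ x) Ω y →
    pLap n p φ y + f y (u y) ≤ 0

/-- The parabolic cylinder `Ω × I`. -/
def pcyl (n : ℕ) (Ω : Set (EuclideanSpace ℝ (Fin n))) (I : Set ℝ) :
    Set (EuclideanSpace ℝ (Fin n) × ℝ) := Ω ×ˢ I

/-- The parabolic boundary `(cl(Ω) × {0}) ∪ (∂Ω × I)`. -/
def pbdry (n : ℕ) (Ω : Set (EuclideanSpace ℝ (Fin n))) (I : Set ℝ) :
    Set (EuclideanSpace ℝ (Fin n) × ℝ) := closure Ω ×ˢ {(0 : ℝ)} ∪ frontier Ω ×ˢ I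

/-- The set of `λ ≥ 0` such that `Δ_p w + λ w^{p−1} = 0` in `Ω`, `w = δ` on `∂Ω`, has a positive
viscosity solution `w ∈ C(cl Ω)`; its supremum is the first eigenvalue `λ_Ω`. -/
def pEigenSet (n : ℕ) (p δ : ℝ) (Ω : Set (EuclideanSpace ℝ (Fin n))) : Set ℝ :=
  {lam : ℝ | 0 ≤ lam ∧ ∃ w : EuclideanSpace ℝ (Fin n) → ℝ,
    ContinuousOn w (closure Ω) ∧ (∀ x ∈ closure Ω, 0 < w x) ∧
    PLapFSub n p (fun _ s => lam * s ^ (p - 1)) Ω w ∧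
    PLapFSuper n p (fun _ s => lam * s ^ (p - 1)) Ω w ∧
    ∀ x ∈ frontier Ω, w x = δ}

/-- A positive viscosity solution of the boundary value problem `Γ_p u = 0` in `Ω × I`,
`u = h` on the parabolic boundary. -/
def TrudBVPSol (n : ℕ) (p : ℝ) (Ω : Set (EuclideanSpace ℝ (Fin n))) (I : Set ℝ)
    (h u : EuclideanSpace ℝ (Fin n) × ℝ → ℝ) : Prop :=
  ContinuousOn u (pcyl n Ω I ∪ pbdry n Ω I) ∧
  (∀ q ∈ pcyl n Ω I ∪ pbdry n Ω I, 0 < u q) ∧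
  TrudSub n p (pcyl n Ω I) u ∧ TrudSuper n p (pcyl n Ω I) u ∧
  ∀ q ∈ pbdry n Ω I, u q = h q

section Envelope

open scoped RealInnerProductSpace
open Topology MeasureTheory

variable {X : Type*} [NormedAddCommGroup X] [InnerProductSpace ℝ X]

/-- A vector whose pairings are dominated by a quadratic function is bounded by its constant. -/
lemma norm_le_of_inner_le_sq {C d : ℝ} (hC : 0 < C) (hd : 0 ≤ d) (q : X)
    (h : ∀ e : X, ⟪q, e⟫ ≤ C * d ^ 2 + C * ‖e‖ ^ 2) : ‖q‖ ≤ 2 * C * d := by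
  have h1 := h ((1 / (2 * C)) • q)
  rw [inner_smul_right, real_inner_self_eq_norm_sq, norm_smul, Real.norm_of_nonneg (by positivity)]
    at h1
  have h2 : ‖q‖ ^ 2 ≤ (2 * C * d) ^ 2 := by
    have h3 : C * (1 / (2 * C) * ‖q‖) ^ 2 = ‖q‖ ^ 2 / (4 * C) := by field_simp; ring
    have h4 : 1 / (2 * C) * ‖q‖ ^ 2 = 2 * (‖q‖ ^ 2 / (4 * C)) := by field_simp; ring
    rw [h3, h4] at h1
    have h5 : ‖q‖ ^ 2 / (4 * C) ≤ C * d ^ 2 := by linarith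
    rw [div_le_iff₀ (by positivity)] at h5
    nlinarith
  exact le_of_abs_le (abs_le_of_sq_le_sq h2 (by positivity))


/-- Affine functions `z ↦ b.1 + ⟪b.2, z⟫` lying below a family of paraboloids: the upper envelope
is attained, and it is semiconcave. -/
lemma exists_envelope [FiniteDimensional ℝ X] {lam : ℝ} (hlam : 0 < lam) (A B : Set (ℝ × X))
    (hA : A.Nonempty) (hB : B.Nonempty)
    (h : ∀ a ∈ A, ∀ b ∈ B, ∀ z : X, a.1 + ⟪a.2, z⟫ ≤ lam * ‖z‖ ^ 2 + (b.1 + ⟪b.2, z⟫)) :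
    ∃ (H : X → ℝ) (w : X → X), (∀ a ∈ A, ∀ z, a.1 + ⟪a.2, z⟫ ≤ H z) ∧
      (∀ b ∈ B, ∀ z, H z ≤ lam * ‖z‖ ^ 2 + (b.1 + ⟪b.2, z⟫)) ∧
      (∀ x z, H x + ⟪w x, z - x⟫ ≤ H z) ∧
      ∀ x z, H z ≤ H x + ⟪w x, z - x⟫ + 2 * lam * ‖z - x‖ ^ 2 := by
  set M : Set (ℝ × X) := {a | ∀ b ∈ B, ∀ z : X, a.1 + ⟪a.2, z⟫ ≤ lam * ‖z‖ ^ 2 + (b.1 + ⟪b.2, z⟫)}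
    with hM
  have hMc : IsClosed M := by
    have : M = ⋂ b ∈ B, ⋂ z : X,
        {a : ℝ × X | a.1 + ⟪a.2, z⟫ ≤ lam * ‖z‖ ^ 2 + (b.1 + ⟪b.2, z⟫)} := by
      ext a; simp [hM]
    rw [this]
    exact isClosed_biInter fun b _ => isClosed_iInter fun z =>
      isClosed_le (by fun_prop) (by fun_prop)
  obtain ⟨a₀, ha₀⟩ := hA
  obtain ⟨b₀, hb₀⟩ := hB
  have hex : ∀ x : X, ∃ a ∈ M, ∀ a' ∈ M, a'.1 + ⟪a'.2, x⟫ ≤ a.1 + ⟪a.2, x⟫ := by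
    intro x
    set m := a₀.1 + ⟪a₀.2, x⟫ with hm
    set N : Set (ℝ × X) := M ∩ {a | m ≤ a.1 + ⟪a.2, x⟫} with hN
    have hNc : IsClosed N := hMc.inter (isClosed_le (by fun_prop) (by fun_prop))
    have hbd : ∃ R : ℝ, ∀ a ∈ N, ‖a.2‖ ≤ R := by
      set K := lam * ‖x‖ ^ 2 + b₀.1 + ‖b₀.2‖ * ‖x‖ - m with hK
      set L := ‖x‖ + ‖b₀.2‖ / (2 * lam) with hL
      refine ⟨4 * lam * (L + |K| + 1) + 1, fun a ha => ?_⟩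
      have h1 := ha.1 b₀ hb₀ (x + (1 / (2 * lam)) • a.2)
      have h2 : m ≤ a.1 + ⟪a.2, x⟫ := ha.2
      rw [inner_add_right, inner_add_right, inner_smul_right, inner_smul_right,
        real_inner_self_eq_norm_sq, norm_add_sq_real, inner_smul_right, norm_smul,
        Real.norm_of_nonneg (by positivity : (0:ℝ) ≤ 1 / (2 * lam))] at h1
      have h3 := real_inner_le_norm b₀.2 x
      have h4 := real_inner_le_norm b₀.2 a.2
      have h5 := real_inner_le_norm x a.2
      have e1 : lam * (‖x‖ ^ 2 + 2 * (1 / (2 * lam) * ⟪x, a.2⟫) + (1 / (2 * lam) * ‖a.2‖) ^ 2) =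
          lam * ‖x‖ ^ 2 + ⟪x, a.2⟫ + ‖a.2‖ ^ 2 / (4 * lam) := by field_simp; ring
      have e2 : 1 / (2 * lam) * ‖a.2‖ ^ 2 = 2 * (‖a.2‖ ^ 2 / (4 * lam)) := by field_simp; ring
      rw [e1, e2] at h1
      have h6 : 1 / (2 * lam) * ⟪b₀.2, a.2⟫ ≤ ‖b₀.2‖ / (2 * lam) * ‖a.2‖ := by
        rw [one_div_mul_eq_div, div_mul_eq_mul_div]
        gcongr
      have h7 : ‖a.2‖ ^ 2 / (4 * lam) ≤ K + L * ‖a.2‖ := by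
        rw [hK, hL]; linarith
      rw [div_le_iff₀ (by positivity)] at h7
      by_contra hcon
      push Not at hcon
      have hL0 : 0 ≤ L := by positivity
      have hK0 := abs_nonneg K
      have hK1 := le_abs_self K
      have h8 : 1 ≤ ‖a.2‖ := by
        have : 0 ≤ 4 * lam * (L + |K| + 1) := by positivity
        linarith
      have h9 : K + L * ‖a.2‖ ≤ (L + |K| + 1) * ‖a.2‖ := by nlinarith
      have h10 : ‖a.2‖ ^ 2 ≤ 4 * lam * (L + |K| + 1) * ‖a.2‖ := by nlinarith
      have h11 : ‖a.2‖ ≤ 4 * lam * (L + |K| + 1) := by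
        by_contra hc
        push Not at hc
        nlinarith
      linarith
    obtain ⟨R, hR⟩ := hbd
    have hNk : IsCompact N := by
      refine Metric.isCompact_of_isClosed_isBounded hNc ?_
      refine (Metric.isBounded_Icc (m - R * ‖x‖) b₀.1).prod
        (Metric.isBounded_closedBall (x := (0 : X)) (r := R)) |>.subset ?_
      intro a ha
      have h1 := ha.1 b₀ hb₀ 0
      have h2 : m ≤ a.1 + ⟪a.2, x⟫ := ha.2
      have h3 := real_inner_le_norm a.2 x
      have h4 := hR a ha
      have h5 : ‖a.2‖ * ‖x‖ ≤ R * ‖x‖ := by gcongr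
      simp only [inner_zero_right, norm_zero] at h1
      refine ⟨⟨by linarith, by linarith⟩, by simpa using h4⟩
    obtain ⟨a, ha, hmax⟩ := hNk.exists_isMaxOn ⟨a₀, h a₀ ha₀, hm.le⟩
      (f := fun a : ℝ × X => a.1 + ⟪a.2, x⟫) (by fun_prop)
    refine ⟨a, ha.1, fun a' ha' => ?_⟩
    by_cases hc : m ≤ a'.1 + ⟪a'.2, x⟫
    · exact hmax ⟨ha', hc⟩
    · exact (not_le.1 hc).le.trans ha.2
  choose f hfM hf using hex
  refine ⟨fun x => (f x).1 + ⟪(f x).2, x⟫, fun x => (f x).2, fun a ha z => hf z a (h a ha),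
    fun b hb z => hfM z b hb z, fun x z => ?_, fun x z => ?_⟩
  · have := hf z (f x) (hfM x)
    rw [inner_sub_right]; linarith
  · set y := x - (z - x) with hy
    have h1 := hf y (f x) (hfM x)
    have h2 : (((f z).1 + (f y).1 + ⟪(f z).2, z - x⟫ - ⟪(f y).2, z - x⟫ - 2 * lam * ‖z - x‖ ^ 2) / 2,
        (1 / 2 : ℝ) • ((f z).2 + (f y).2)) ∈ M := by
      intro b hb v
      have h3 := hfM z b hb (v + (z - x))
      have h4 := hfM y b hb (v - (z - x))
      simp only [inner_add_right, inner_sub_right, inner_add_left, inner_smul_left,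
        norm_add_sq_real, norm_sub_sq_real] at h3 h4 ⊢
      simp only [conj_trivial]
      linarith
    have h5 := hf x _ h2
    simp only [hy, inner_sub_right, inner_add_left, inner_smul_left, conj_trivial] at h1 h5 ⊢
    linarith

/-- Gradients of functions squeezed between affine functions and paraboloids are Lipschitz. -/
lemma lipschitzWith_of_quadratic_bounds {C : ℝ} (hC : 0 < C) {H : X → ℝ} {w : X → X}
    (hl : ∀ x z, H x + ⟪w x, z - x⟫ ≤ H z)
    (hu : ∀ x z, H z ≤ H x + ⟪w x, z - x⟫ + C * ‖z - x‖ ^ 2) :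
    LipschitzWith (2 * C).toNNReal w := by
  refine LipschitzWith.of_dist_le_mul fun x y => ?_
  rw [Real.coe_toNNReal _ (by positivity), dist_eq_norm, dist_eq_norm]
  refine norm_le_of_inner_le_sq hC (norm_nonneg _) _ fun e => ?_
  have h1 := hl x (y + e)
  have h2 := hu y (y + e)
  have h3 := hu x y
  rw [norm_sub_rev y x] at h3
  simp only [inner_add_right, inner_sub_right, inner_sub_left, add_sub_cancel_left] at h1 h2 h3 ⊢
  linarith

lemma hasFDerivAt_of_quadratic_bounds {C : ℝ} {H : X → ℝ} {w : X → X}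
    (hl : ∀ x z, H x + ⟪w x, z - x⟫ ≤ H z)
    (hu : ∀ x z, H z ≤ H x + ⟪w x, z - x⟫ + C * ‖z - x‖ ^ 2) (x : X) :
    HasFDerivAt H (innerSL ℝ (w x)) x := by
  rw [hasFDerivAt_iff_isLittleO]
  have h1 : (fun z => H z - H x - innerSL ℝ (w x) (z - x)) =O[𝓝 x] fun z => ‖z - x‖ ^ 2 := by
    refine Asymptotics.IsBigO.of_bound C (Eventually.of_forall fun z => ?_)
    have := hl x z
    have := hu x z
    simp only [innerSL_apply_apply]
    rw [Real.norm_of_nonneg (by linarith), Real.norm_of_nonneg (by positivity)]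
    linarith
  refine h1.trans_isLittleO ?_
  have h2 : (fun e : X => ‖e‖ ^ 2) =o[𝓝 0] fun e : X => e := by
    refine Asymptotics.isLittleO_norm_right.1 ?_
    have := (Asymptotics.isLittleO_pow_id (𝕜 := ℝ) (n := 2) (by norm_num)).comp_tendsto
      (tendsto_norm_zero (E := X))
    simpa [Function.comp_def] using this
  have h3 : Tendsto (fun z : X => z - x) (𝓝 x) (𝓝 0) := by
    have : ContinuousAt (fun z : X => z - x) x := by fun_prop
    simpa [ContinuousAt] using this
  exact h2.comp_tendsto h3

/-- If the gradient field is differentiable at a point, the function has a second order Taylor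
expansion there. -/
lemma eventually_taylor_two {H : X → ℝ} {w : X → X}
    (hH : ∀ x, HasFDerivAt H (innerSL ℝ (w x)) x) {x : X} {A : X →L[ℝ] X}
    (hA : HasFDerivAt w A x) {δ : ℝ} (hδ : 0 < δ) :
    ∀ᶠ e in 𝓝 (0 : X), |H (x + e) - H x - ⟪w x, e⟫ - 1 / 2 * ⟪A e, e⟫| ≤ δ * ‖e‖ ^ 2 := by
  have h1 := (hasFDerivAt_iff_isLittleO_nhds_zero.1 hA).bound hδ
  obtain ⟨r, hr, hb⟩ := Metric.eventually_nhds_iff_ball.1 h1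
  refine Metric.eventually_nhds_iff_ball.2 ⟨r, hr, fun e he => ?_⟩
  set φ : ℝ → ℝ := fun s => H (x + s • e) - s * ⟪w x, e⟫ - s ^ 2 * (1 / 2 * ⟪A e, e⟫) with hφ
  have hd : ∀ s ∈ Icc (0 : ℝ) 1, HasDerivWithinAt φ
      (⟪w (x + s • e) - w x - A (s • e), e⟫) (Icc 0 1) s := by
    intro s _
    have hline : HasDerivAt (fun s : ℝ => x + s • e) e s := by
      simpa using ((hasDerivAt_id s).smul_const e).const_add x
    have h2 := (hH (x + s • e)).comp_hasDerivAt s hline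
    have h3 := (h2.sub ((hasDerivAt_id s).mul_const ⟪w x, e⟫)).sub
      (((hasDerivAt_id s).pow 2).mul_const (1 / 2 * ⟪A e, e⟫))
    refine (h3.congr_deriv ?_).hasDerivWithinAt
    simp only [innerSL_apply_apply, inner_sub_left, map_smul, inner_smul_left, conj_trivial, id]
    push_cast
    ring
  have h4 := Convex.norm_image_sub_le_of_norm_hasDerivWithin_le (C := δ * ‖e‖ ^ 2) hd
    (fun s hs => ?_) (convex_Icc 0 1) (left_mem_Icc.2 zero_le_one) (right_mem_Icc.2 zero_le_one)
  · simp only [hφ, one_smul, zero_smul, add_zero, Real.norm_eq_abs] at h4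
    have e1 : H (x + e) - H x - ⟪w x, e⟫ - 1 / 2 * ⟪A e, e⟫ =
        H (x + e) - 1 * ⟪w x, e⟫ - 1 ^ 2 * (1 / 2 * ⟪A e, e⟫) -
          (H x - 0 * ⟪w x, e⟫ - 0 ^ 2 * (1 / 2 * ⟪A e, e⟫)) := by ring
    rw [e1]
    simpa using h4
  · have hse : ‖s • e‖ ≤ ‖e‖ := by
      rw [norm_smul, Real.norm_of_nonneg hs.1]
      exact mul_le_of_le_one_left (norm_nonneg _) hs.2
    have h5 := hb (s • e) (by
      rw [mem_ball_zero_iff] at he ⊢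
      exact hse.trans_lt he)
    calc ‖⟪w (x + s • e) - w x - A (s • e), e⟫‖ ≤ ‖w (x + s • e) - w x - A (s • e)‖ * ‖e‖ :=
          norm_inner_le_norm _ _
      _ ≤ δ * ‖e‖ * ‖e‖ := by gcongr; exact h5.trans (by gcongr)
      _ = δ * ‖e‖ ^ 2 := by ring

/-- The penalized difference used when doubling variables, with a linear perturbation. -/
noncomputable def penalizedDiff (U V : X → ℝ) (lam : ℝ) (p x y : X) : ℝ :=
  U x - V y - lam / 4 * ‖x - y‖ ^ 2 - ⟪p, (1 / 2 : ℝ) • (x + y)⟫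

/-- `(x, y)` maximizes the penalized difference over `S × S`. -/
def IsDoublingMax (S : Set X) (U V : X → ℝ) (lam : ℝ) (p x y : X) : Prop :=
  x ∈ S ∧ y ∈ S ∧ ∀ x' ∈ S, ∀ y' ∈ S,
    penalizedDiff U V lam p x' y' ≤ penalizedDiff U V lam p x y

lemma exists_isDoublingMax {S : Set X} (hS : IsCompact S) (hne : S.Nonempty) {U V : X → ℝ}
    (hU : UpperSemicontinuousOn U S) (hV : LowerSemicontinuousOn V S) (lam : ℝ) (p : X) :
    ∃ x y, IsDoublingMax S U V lam p x y := by
  have h1 : UpperSemicontinuousOn (fun q : X × X => U q.1) (S ×ˢ S) :=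
    hU.comp continuousOn_fst fun q hq => hq.1
  have h2 : UpperSemicontinuousOn (fun q : X × X => (-V) q.2) (S ×ˢ S) :=
    hV.neg.comp continuousOn_snd fun q hq => hq.2
  have h3 : UpperSemicontinuousOn (fun q : X × X =>
      -(lam / 4 * ‖q.1 - q.2‖ ^ 2) - ⟪p, (1 / 2 : ℝ) • (q.1 + q.2)⟫) (S ×ˢ S) :=
    ContinuousOn.upperSemicontinuousOn (by fun_prop)
  obtain ⟨q, hq, hmax⟩ := ((h1.add h2).add h3).exists_isMaxOn (hne.prod hne) (hS.prod hS)
  refine ⟨q.1, q.2, hq.1, hq.2, fun x' hx' y' hy' => ?_⟩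
  have := hmax (mk_mem_prod hx' hy')
  simp only [mem_ofPred_eq, Pi.neg_apply] at this
  unfold penalizedDiff
  linarith

lemma doubling_identity (U V : X → ℝ) {lam : ℝ} (hlam : 0 < lam) (p x y z : X) :
    U x - V y - lam / 2 * (‖x - z‖ ^ 2 + ‖y - z‖ ^ 2) =
      penalizedDiff U V lam p x y + ‖p‖ ^ 2 / (4 * lam) + ⟪p, z⟫ -
        lam * ‖z - ((1 / 2 : ℝ) • (x + y) - (1 / (2 * lam)) • p)‖ ^ 2 := by
  unfold penalizedDiff
  simp only [← real_inner_self_eq_norm_sq, inner_sub_left, inner_sub_right, inner_add_left,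
    inner_add_right, inner_smul_left, inner_smul_right, conj_trivial]
  rw [real_inner_comm x y, real_inner_comm x z, real_inner_comm y z, real_inner_comm p x,
    real_inner_comm p y, real_inner_comm p z]
  field_simp
  ring

/-- The perturbation is a Lipschitz function of the contact point. -/
lemma IsDoublingMax.norm_sub_le {S : Set X} {U V : X → ℝ} {lam : ℝ} (hlam : 0 < lam)
    {p x y p' x' y' : X} (h : IsDoublingMax S U V lam p x y)
    (h' : IsDoublingMax S U V lam p' x' y') :
    ‖p - p'‖ ≤ 4 * lam * ‖((1 / 2 : ℝ) • (x + y) - (1 / (2 * lam)) • p) -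
      ((1 / 2 : ℝ) • (x' + y') - (1 / (2 * lam)) • p')‖ := by
  set c := (1 / 2 : ℝ) • (x + y) - (1 / (2 * lam)) • p with hc
  set c' := (1 / 2 : ℝ) • (x' + y') - (1 / (2 * lam)) • p' with hc'
  have key : 4 * lam * ‖c - c'‖ = 2 * (2 * lam) * ‖c - c'‖ := by ring
  rw [key]
  refine norm_le_of_inner_le_sq (by positivity) (norm_nonneg _) _ fun e => ?_
  have h1 := doubling_identity U V hlam p x y (c' + e)
  have h2 := doubling_identity U V hlam p' x y (c' + e)
  have h3 := doubling_identity U V hlam p x' y' c'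
  have h4 := doubling_identity U V hlam p' x' y' c'
  rw [← hc] at h1
  rw [← hc'] at h4
  have h5 := h'.2.2 x h.1 y h.2.1
  have h6 := h.2.2 x' h'.1 y' h'.2.1
  have h7 : 0 ≤ lam * ‖c' + e - ((1 / 2 : ℝ) • (x + y) - (1 / (2 * lam)) • p')‖ ^ 2 := by
    positivity
  have h8 : 0 ≤ lam * ‖c' - ((1 / 2 : ℝ) • (x' + y') - (1 / (2 * lam)) • p)‖ ^ 2 := by
    positivity
  have h9 : ‖c' + e - c‖ ^ 2 ≤ 2 * ‖c - c'‖ ^ 2 + 2 * ‖e‖ ^ 2 := by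
    have h10 : ‖c' + e - c‖ ≤ ‖c - c'‖ + ‖e‖ := by
      rw [norm_sub_rev c c', add_sub_right_comm]; exact norm_add_le _ _
    nlinarith [norm_nonneg (c' + e - c), sq_nonneg (‖c - c'‖ - ‖e‖)]
  simp only [sub_self, norm_zero, inner_add_right, inner_sub_left] at *
  nlinarith

/-- Theorem on sums: a perturbed maximum of the doubled function is attained at points where
second order expansions with the same Hessian are available. -/
lemma exists_jets [FiniteDimensional ℝ X] {S : Set X} (hS : IsCompact S) (hne : S.Nonempty)
    {U V : X → ℝ} (hU : UpperSemicontinuousOn U S) (hV : LowerSemicontinuousOn V S)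
    {lam r : ℝ} (hlam : 0 < lam) (hr : 0 < r) :
    ∃ (p x y : X) (A : X →L[ℝ] X), ‖p‖ < r ∧ IsDoublingMax S U V lam p x y ∧ ‖A‖ ≤ 5 * lam ∧
      (∀ δ > 0, ∀ᶠ e in 𝓝 (0 : X), x + e ∈ S → U (x + e) ≤ U x +
        ⟪(lam / 2) • (x - y) + (1 / 2 : ℝ) • p, e⟫ + 1 / 2 * ⟪A e, e⟫ + δ * ‖e‖ ^ 2) ∧
      (∀ δ > 0, ∀ᶠ e in 𝓝 (0 : X), y + e ∈ S → V y +
        ⟪(lam / 2) • (x - y) - (1 / 2 : ℝ) • p, e⟫ + 1 / 2 * ⟪A e, e⟫ - δ * ‖e‖ ^ 2 ≤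
          V (y + e)) := by
  borelize X
  set A : Set (ℝ × X) := (fun x => (U x - lam / 2 * ‖x‖ ^ 2, lam • x)) '' S with hA
  set B : Set (ℝ × X) := {b | ∃ y ∈ S, ∃ p x₀ y₀ : X, ‖p‖ < r ∧ IsDoublingMax S U V lam p x₀ y₀ ∧
    b = (V y + lam / 2 * ‖y‖ ^ 2 + (penalizedDiff U V lam p x₀ y₀ + ‖p‖ ^ 2 / (4 * lam)),
      p - lam • y)} with hB
  have hex := exists_isDoublingMax hS hne hU hV lam
  have hAne : A.Nonempty := hne.image _
  have hBne : B.Nonempty := by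
    obtain ⟨y, hy⟩ := hne
    obtain ⟨x₀, y₀, h0⟩ := hex 0
    exact ⟨_, y, hy, 0, x₀, y₀, by simpa using hr, h0, rfl⟩
  have hAB : ∀ a ∈ A, ∀ b ∈ B, ∀ z : X,
      a.1 + ⟪a.2, z⟫ ≤ lam * ‖z‖ ^ 2 + (b.1 + ⟪b.2, z⟫) := by
    rintro _ ⟨x, hx, rfl⟩ _ ⟨y, hy, p, x₀, y₀, -, h0, rfl⟩ z
    have h1 := doubling_identity U V hlam p x y z
    have h2 := h0.2.2 x hx y hy
    have h3 : 0 ≤ lam * ‖z - ((1 / 2 : ℝ) • (x + y) - (1 / (2 * lam)) • p)‖ ^ 2 := by positivity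
    generalize ‖z - ((1 / 2 : ℝ) • (x + y) - (1 / (2 * lam)) • p)‖ = t at h1 h3
    simp only [inner_sub_left, inner_smul_left, conj_trivial, norm_sub_sq_real] at h1 ⊢
    linarith
  obtain ⟨H, w, hHA, hHB, hl, hu⟩ := exists_envelope hlam A B hAne hBne hAB
  have hLip := lipschitzWith_of_quadratic_bounds (by positivity) hl hu
  set d := Module.finrank ℝ X with hd
  have hae := hLip.ae_differentiableAt (μ := Measure.hausdorffMeasure (d : ℝ))
  set K : Set X := {c | ∃ p x y : X, ‖p‖ < r ∧ IsDoublingMax S U V lam p x y ∧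
    c = (1 / 2 : ℝ) • (x + y) - (1 / (2 * lam)) • p} with hK
  have hgood : ∃ c ∈ K, DifferentiableAt ℝ w c := by
    by_contra! hcon
    have hK0 : Measure.hausdorffMeasure (d : ℝ) K = 0 := measure_mono_null hcon hae
    have hKp : ∀ c ∈ K, ∃ p x y : X, ‖p‖ < r ∧ IsDoublingMax S U V lam p x y ∧
      c = (1 / 2 : ℝ) • (x + y) - (1 / (2 * lam)) • p := fun c hc => hc
    choose! P x y hPr hPm hPc using hKp
    have hPL : LipschitzOnWith (4 * lam).toNNReal P K := by
      refine LipschitzOnWith.of_dist_le_mul fun c hc c' hc' => ?_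
      rw [Real.coe_toNNReal _ (by positivity), dist_eq_norm, dist_eq_norm]
      have := (hPm c hc).norm_sub_le hlam (hPm c' hc')
      rwa [← hPc c hc, ← hPc c' hc'] at this
    have hball : Metric.ball (0 : X) r ⊆ P '' K := by
      intro p hp
      obtain ⟨x₀, y₀, h0⟩ := hex p
      have hc : (1 / 2 : ℝ) • (x₀ + y₀) - (1 / (2 * lam)) • p ∈ K :=
        ⟨p, x₀, y₀, by simpa using hp, h0, rfl⟩
      refine ⟨_, hc, ?_⟩
      have := (hPm _ hc).norm_sub_le hlam h0
      rw [← hPc _ hc, sub_self, norm_zero, mul_zero] at this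
      exact sub_eq_zero.1 (norm_le_zero_iff.1 this)
    have h1 : Measure.hausdorffMeasure (d : ℝ) (P '' K) = 0 := by
      have := hPL.hausdorffMeasure_image_le (d := (d : ℝ)) (by positivity)
      rw [hK0, mul_zero] at this
      exact le_antisymm this bot_le
    exact (Metric.measure_ball_pos (Measure.hausdorffMeasure (d : ℝ)) (0 : X) hr).ne'
      (measure_mono_null hball h1)
  obtain ⟨c, ⟨p, x, y, hpr, hmax, hc⟩, hdiff⟩ := hgood
  have hid := doubling_identity U V hlam p x y c
  rw [← hc, sub_self, norm_zero] at hid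
  have hHc : H c = U x - lam / 2 * ‖x‖ ^ 2 + lam * ⟪x, c⟫ := by
    have h1 := hHA _ ⟨x, hmax.1, rfl⟩ c
    have h2 := hHB _ ⟨y, hmax.2.1, p, x, y, hpr, hmax, rfl⟩ c
    simp only [inner_sub_left, inner_smul_left, conj_trivial, norm_sub_sq_real] at h1 h2 hid
    linarith
  have hwc : w c = lam • x := by
    refine (sub_eq_zero.1 (norm_le_zero_iff.1 ?_)).symm
    have := norm_le_of_inner_le_sq (C := 2 * lam) (d := 0) (by positivity) le_rfl (lam • x - w c)
      fun e => ?_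
    · simpa using this
    · have h1 := hHA _ ⟨x, hmax.1, rfl⟩ (c + e)
      have h2 := hu c (c + e)
      simp only [inner_sub_left, inner_smul_left, conj_trivial, inner_add_right,
        add_sub_cancel_left] at h1 h2 ⊢
      linarith
  have hg : lam • (x - c) = (lam / 2) • (x - y) + (1 / 2 : ℝ) • p := by
    rw [hc, smul_sub, smul_sub, smul_smul, smul_smul]
    have : lam * (1 / (2 * lam)) = 1 / 2 := by field_simp
    rw [this]
    module
  have hg' : (lam / 2) • (x - y) - (1 / 2 : ℝ) • p = lam • (x - c) - p := by
    rw [hg]; module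
  have htay := fun δ (hδ : (0 : ℝ) < δ) => eventually_taylor_two
    (hasFDerivAt_of_quadratic_bounds hl hu) hdiff.hasFDerivAt hδ
  refine ⟨p, x, y, fderiv ℝ w c - lam • ContinuousLinearMap.id ℝ X, hpr, hmax, ?_, ?_, ?_⟩
  · have h1 := hdiff.hasFDerivAt.le_of_lipschitz hLip
    rw [Real.coe_toNNReal _ (by positivity)] at h1
    have h2 : ‖lam • ContinuousLinearMap.id ℝ X‖ ≤ lam := by
      rw [norm_smul, Real.norm_of_nonneg hlam.le]
      exact mul_le_of_le_one_right hlam.le ContinuousLinearMap.norm_id_le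
    have := norm_sub_le (fderiv ℝ w c) (lam • ContinuousLinearMap.id ℝ X)
    linarith
  · intro δ hδ
    filter_upwards [htay δ hδ] with e he hxe
    have h1 := hHA _ ⟨x + e, hxe, rfl⟩ (c + e)
    have h2 := (abs_le.1 he).2
    rw [hwc] at h2
    rw [← hg]
    simp only [sub_apply, smul_apply,
      ContinuousLinearMap.id_apply, inner_sub_left, inner_smul_left, conj_trivial, inner_add_left,
      inner_add_right, norm_add_sq_real, real_inner_self_eq_norm_sq] at h1 h2 ⊢
    rw [real_inner_comm c e] at h1
    linarith
  · intro δ hδ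
    filter_upwards [htay δ hδ] with e he hye
    have h1 := hHB _ ⟨y + e, hye, p, x, y, hpr, hmax, rfl⟩ (c + e)
    have h2 := (abs_le.1 he).1
    rw [hwc] at h2
    rw [hg']
    simp only [sub_apply, smul_apply,
      ContinuousLinearMap.id_apply, inner_sub_left, inner_smul_left, conj_trivial, inner_add_left,
      inner_add_right, norm_add_sq_real, norm_sub_sq_real, real_inner_self_eq_norm_sq] at h1 h2 hid ⊢
    rw [real_inner_comm c e] at h1
    linarith

/-- For a large penalization and a small perturbation, the maximum points of the doubled function
avoid the part of `S` where `U ≤ V`. -/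
lemma exists_isDoublingMax_mem {S O : Set X} (hS : IsCompact S) (hO : IsOpen O) {U V : X → ℝ}
    (hU : UpperSemicontinuousOn U S) (hV : LowerSemicontinuousOn V S)
    (hle : ∀ q ∈ S, q ∉ O → U q ≤ V q) {q₀ : X} (hq₀ : q₀ ∈ S) (hlt : V q₀ < U q₀) :
    ∃ lam > 0, ∃ r > 0, ∀ p x y : X, ‖p‖ < r → IsDoublingMax S U V lam p x y →
      x ∈ O ∧ y ∈ O := by
  by_contra! hcon
  have hk : ∀ k : ℕ, ∃ p x y : X, ‖p‖ < 1 / ((k : ℝ) + 1) ∧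
      IsDoublingMax S U V ((k : ℝ) + 1) p x y ∧ (x ∈ O → y ∉ O) :=
    fun k => hcon _ (by positivity) _ (by positivity)
  choose p x y hp hmax hout using hk
  obtain ⟨⟨a, b⟩, hab, φ, hφ, hlim⟩ := (hS.prod hS).tendsto_subseq
    (x := fun k => (x k, y k)) fun k => ⟨(hmax k).1, (hmax k).2.1⟩
  have hxa : Tendsto (fun k => x (φ k)) atTop (𝓝 a) := (continuous_fst.tendsto _).comp hlim
  have hyb : Tendsto (fun k => y (φ k)) atTop (𝓝 b) := (continuous_snd.tendsto _).comp hlim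
  have hd0 : Tendsto (fun k : ℕ => 1 / ((k : ℝ) + 1)) atTop (𝓝 0) :=
    tendsto_one_div_add_atTop_nhds_zero_nat
  have hp0 : Tendsto (fun k => p (φ k)) atTop (𝓝 0) :=
    (squeeze_zero_norm (fun k => (hp k).le) hd0).comp hφ.tendsto_atTop
  obtain ⟨CU, hCU⟩ := hU.bddAbove_of_isCompact hS
  obtain ⟨CV, hCV⟩ := hV.bddBelow_of_isCompact hS
  set err : ℕ → ℝ := fun k =>
    ⟪p (φ k), (1 / 2 : ℝ) • (x (φ k) + y (φ k))⟫ - ⟪p (φ k), (1 / 2 : ℝ) • (q₀ + q₀)⟫ with herr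
  have herr0 : Tendsto err atTop (𝓝 0) := by
    have := (hp0.inner (𝕜 := ℝ) ((hxa.add hyb).const_smul (1 / 2 : ℝ))).sub
      (hp0.inner (𝕜 := ℝ) (tendsto_const_nhds (x := (1 / 2 : ℝ) • (q₀ + q₀))))
    rw [inner_zero_left, inner_zero_left, sub_zero] at this
    exact this
  have hmain : ∀ k, U q₀ - V q₀ + err k + ((φ k : ℝ) + 1) / 4 * ‖x (φ k) - y (φ k)‖ ^ 2 ≤
      U (x (φ k)) - V (y (φ k)) := by
    intro k
    have := (hmax (φ k)).2.2 q₀ hq₀ q₀ hq₀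
    simp only [penalizedDiff, sub_self, norm_zero] at this
    simp only [herr]
    linarith
  have hUx : ∀ k, U (x (φ k)) ≤ CU := fun k => hCU ⟨_, (hmax (φ k)).1, rfl⟩
  have hVy : ∀ k, CV ≤ V (y (φ k)) := fun k => hCV ⟨_, (hmax (φ k)).2.1, rfl⟩
  have hdist : Tendsto (fun k => ‖x (φ k) - y (φ k)‖ ^ 2) atTop (𝓝 0) := by
    have h1 : Tendsto (fun k => 4 * (CU - CV - (U q₀ - V q₀) - err k) * (1 / ((φ k : ℝ) + 1)))
        atTop (𝓝 0) := by
      have := ((tendsto_const_nhds (x := CU - CV - (U q₀ - V q₀))).sub herr0).const_mul 4 |>.mul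
        (hd0.comp hφ.tendsto_atTop)
      simpa using this
    refine squeeze_zero (fun k => by positivity) (fun k => ?_) h1
    have h2 := hmain k
    have h3 := hUx k
    have h4 := hVy k
    rw [mul_one_div, le_div_iff₀ (by positivity)]
    linarith
  have hba : b = a := by
    have h1 : Tendsto (fun k => ‖x (φ k) - y (φ k)‖ ^ 2) atTop (𝓝 (‖a - b‖ ^ 2)) :=
      ((hxa.sub hyb).norm).pow 2
    have h2 := tendsto_nhds_unique h1 hdist
    rw [sq_eq_zero_iff, norm_eq_zero, sub_eq_zero] at h2
    exact h2.symm
  subst hba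
  have hbS : b ∈ S := hab.1
  have hxW : Tendsto (fun k => x (φ k)) atTop (𝓝[S] b) :=
    tendsto_nhdsWithin_iff.2 ⟨hxa, Eventually.of_forall fun k => (hmax (φ k)).1⟩
  have hyW : Tendsto (fun k => y (φ k)) atTop (𝓝[S] b) :=
    tendsto_nhdsWithin_iff.2 ⟨hyb, Eventually.of_forall fun k => (hmax (φ k)).2.1⟩
  set η := (U q₀ - V q₀) / 4 with hη
  have hη0 : 0 < η := by rw [hη]; linarith
  have e1 := hxW.eventually (hU b hbS (U b + η) (by linarith))
  have e2 := hyW.eventually (hV b hbS (V b - η) (by linarith))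
  have e3 := herr0.eventually (lt_mem_nhds (by linarith : -η < 0))
  have hbO : b ∈ O := by
    by_contra hb
    have h1 := hle b hbS hb
    obtain ⟨k, h2, h3, h4⟩ := (e1.and (e2.and e3)).exists
    have h5 := hmain k
    have h6 : 0 ≤ ((φ k : ℝ) + 1) / 4 * ‖x (φ k) - y (φ k)‖ ^ 2 := by positivity
    linarith
  obtain ⟨k, h1, h2⟩ :=
    ((hxa.eventually (hO.mem_nhds hbO)).and (hyb.eventually (hO.mem_nhds hbO))).exists
  exact hout _ h1 h2

end Envelope

section Parabolic

open scoped RealInnerProductSpace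
open Topology

/-- The spatial part of `G_p` as a function of the gradient `a` and the Hessian `B`. -/
noncomputable def gpOperator (n : ℕ) (p : ℝ) (a : EuclideanSpace ℝ (Fin n))
    (B : EuclideanSpace ℝ (Fin n) →L[ℝ] EuclideanSpace ℝ (Fin n)) : ℝ :=
  ‖a‖ ^ (p - 2) * ∑ i : Fin n,
      ⟪B (EuclideanSpace.single i (1 : ℝ)), EuclideanSpace.single i (1 : ℝ)⟫ +
    (p - 2) * (‖a‖ ^ (p - 4) * ⟪B a, a⟫) + (p - 1) * ‖a‖ ^ p

lemma continuous_gpOperator (n : ℕ) {p : ℝ} (hp : 2 ≤ p) :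
    Continuous fun q : EuclideanSpace ℝ (Fin n) ×
      (EuclideanSpace ℝ (Fin n) →L[ℝ] EuclideanSpace ℝ (Fin n)) => gpOperator n p q.1 q.2 := by
  unfold gpOperator
  refine Continuous.add (Continuous.add (Continuous.mul ?_ (by fun_prop)) ?_)
    (Continuous.mul continuous_const ?_)
  · exact continuous_fst.norm.rpow_const fun _ => Or.inr (by linarith)
  · rcases hp.eq_or_lt with rfl | hp2
    · simp only [sub_self, zero_mul]
      exact continuous_const
    refine continuous_const.mul (continuous_iff_continuousAt.2 fun ⟨a, B⟩ => ?_)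
    by_cases ha : a = 0
    · subst ha
      have h0 : ‖(0 : EuclideanSpace ℝ (Fin n))‖ ^ (p - 4) *
          ⟪B (0 : EuclideanSpace ℝ (Fin n)), (0 : EuclideanSpace ℝ (Fin n))⟫ = 0 := by simp
      rw [ContinuousAt, h0]
      have h1 : Continuous fun q : EuclideanSpace ℝ (Fin n) ×
          (EuclideanSpace ℝ (Fin n) →L[ℝ] EuclideanSpace ℝ (Fin n)) => ‖q.1‖ ^ (p - 2) * ‖q.2‖ :=
        (continuous_fst.norm.rpow_const fun _ => Or.inr (by linarith)).mul continuous_snd.norm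
      have h2 := h1.tendsto ((0 : EuclideanSpace ℝ (Fin n)), B)
      simp only [norm_zero] at h2
      rw [Real.zero_rpow (by linarith), zero_mul] at h2
      refine squeeze_zero_norm (fun q => ?_) h2
      rw [norm_mul, Real.norm_of_nonneg (by positivity)]
      by_cases hq : q.1 = 0
      · rw [hq]; simp; positivity
      have hq' : 0 < ‖q.1‖ := norm_pos_iff.2 hq
      have h3 : ‖⟪q.2 q.1, q.1⟫‖ ≤ ‖q.2‖ * ‖q.1‖ * ‖q.1‖ :=
        (norm_inner_le_norm _ _).trans (by gcongr; exact q.2.le_opNorm _)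
      have h4 : ‖q.1‖ ^ (p - 2) = ‖q.1‖ ^ (p - 4) * (‖q.1‖ * ‖q.1‖) := by
        rw [← pow_two, ← Real.rpow_natCast, ← Real.rpow_add hq']
        congr 1
        norm_num
        ring
      rw [h4]
      calc _ ≤ ‖q.1‖ ^ (p - 4) * (‖q.2‖ * ‖q.1‖ * ‖q.1‖) := by gcongr
        _ = _ := by ring
    · refine ContinuousAt.mul (ContinuousAt.rpow_const (by fun_prop) (Or.inl ?_)) (by fun_prop)
      simpa using ha
  · exact continuous_fst.norm.rpow_const fun _ => Or.inr (by linarith)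

section Quadratic

variable {X : Type*} [NormedAddCommGroup X] [InnerProductSpace ℝ X] [CompleteSpace X]

lemma hasGradientAt_quadratic (c : ℝ) (a x₀ : X) (B : X →L[ℝ] X) (x : X) :
    HasGradientAt (fun x => c + ⟪a, x - x₀⟫ + 1 / 2 * ⟪B (x - x₀), x - x₀⟫)
      (a + (1 / 2 : ℝ) • (B + ContinuousLinearMap.adjoint B) (x - x₀)) x := by
  rw [hasGradientAt_iff_hasFDerivAt]
  have h0 : HasFDerivAt (fun x : X => x - x₀) (ContinuousLinearMap.id ℝ X) x :=
    (hasFDerivAt_id x).sub_const x₀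
  have h1 := (((hasFDerivAt_const a x).inner ℝ h0).const_add c).add
    (((B.hasFDerivAt.comp x h0).inner ℝ h0).const_mul (1 / 2 : ℝ))
  refine h1.congr_fderiv ?_
  ext v
  simp only [fderivInnerCLM_apply, inner_add_left, inner_smul_left, conj_trivial,
    ContinuousLinearMap.adjoint_inner_left, InnerProductSpace.toDual_apply_apply, Function.comp_apply,
    add_apply, smul_apply, ContinuousLinearMap.comp_apply,
    ContinuousLinearMap.prod_apply, ContinuousLinearMap.id_apply, zero_apply,
    inner_zero_left, smul_eq_mul, add_zero]
  rw [real_inner_comm (B v)]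

lemma iteratedFDeriv_two_quadratic (c : ℝ) (a x₀ : X) (B : X →L[ℝ] X) (x v : X) :
    iteratedFDeriv ℝ 2 (fun x => c + ⟪a, x - x₀⟫ + 1 / 2 * ⟪B (x - x₀), x - x₀⟫) x ![v, v] =
      ⟪B v, v⟫ := by
  rw [iteratedFDeriv_two_apply]
  have h1 : fderiv ℝ (fun x => c + ⟪a, x - x₀⟫ + 1 / 2 * ⟪B (x - x₀), x - x₀⟫) =
      fun x => innerSL ℝ a +
        (innerSL ℝ).comp ((1 / 2 : ℝ) • (B + ContinuousLinearMap.adjoint B)) (x - x₀) := by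
    ext y w
    rw [(hasGradientAt_quadratic c a x₀ B y).hasFDerivAt.fderiv]
    simp
  rw [h1]
  have h2 : HasFDerivAt (fun x : X => innerSL ℝ a +
      (innerSL ℝ).comp ((1 / 2 : ℝ) • (B + ContinuousLinearMap.adjoint B)) (x - x₀))
      ((innerSL ℝ).comp ((1 / 2 : ℝ) • (B + ContinuousLinearMap.adjoint B))) x := by
    have h0 : HasFDerivAt (fun x : X => x - x₀) (ContinuousLinearMap.id ℝ X) x :=
      (hasFDerivAt_id x).sub_const x₀
    exact (ContinuousLinearMap.hasFDerivAt _).comp x h0 |>.const_add _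
  rw [h2.fderiv]
  simp [ContinuousLinearMap.adjoint_inner_left, real_inner_comm]
  ring

end Quadratic

lemma pLap_quadratic (n : ℕ) (p c : ℝ) (a x₀ : EuclideanSpace ℝ (Fin n))
    (B : EuclideanSpace ℝ (Fin n) →L[ℝ] EuclideanSpace ℝ (Fin n)) :
    pLap n p (fun x => c + ⟪a, x - x₀⟫ + 1 / 2 * ⟪B (x - x₀), x - x₀⟫) x₀ +
      (p - 1) * ‖gradient (fun x => c + ⟪a, x - x₀⟫ + 1 / 2 * ⟪B (x - x₀), x - x₀⟫) x₀‖ ^ p =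
      gpOperator n p a B := by
  have hg : gradient (fun x => c + ⟪a, x - x₀⟫ + 1 / 2 * ⟪B (x - x₀), x - x₀⟫) x₀ = a := by
    simpa using (hasGradientAt_quadratic c a x₀ B x₀).gradient
  unfold pLap gpOperator
  rw [hg]
  simp only [iteratedFDeriv_two_quadratic]
  split_ifs with h1 h2
  · subst h1 h2; simp
  · subst h1
    rw [norm_zero, Real.zero_rpow (sub_ne_zero.2 h2)]
    simp
  · ring

/-- Space-time with its Euclidean structure. -/
abbrev SpaceTime (n : ℕ) : Type := WithLp 2 (EuclideanSpace ℝ (Fin n) × ℝ)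

/-- The identification of `ℝⁿ × ℝ` with Euclidean space-time. -/
noncomputable abbrev toSpaceTime (n : ℕ) : (EuclideanSpace ℝ (Fin n) × ℝ) ≃L[ℝ] SpaceTime n :=
  (WithLp.prodContinuousLinearEquiv 2 ℝ (EuclideanSpace ℝ (Fin n)) ℝ).symm

/-- The spatial block of an operator on space-time. -/
noncomputable def spaceBlock (n : ℕ) (A : SpaceTime n →L[ℝ] SpaceTime n) :
    EuclideanSpace ℝ (Fin n) →L[ℝ] EuclideanSpace ℝ (Fin n) :=
  (ContinuousLinearMap.fst ℝ _ ℝ).comp (((toSpaceTime n).symm : SpaceTime n →L[ℝ] _).comp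
    (A.comp ((toSpaceTime n : _ →L[ℝ] SpaceTime n).comp (ContinuousLinearMap.inl ℝ _ ℝ))))

lemma continuous_spaceBlock (n : ℕ) : Continuous (spaceBlock n) := by
  unfold spaceBlock
  fun_prop

/-- The quadratic test function with gradient `g` and Hessian `A` at `q₀`, plus a function of
time. -/
noncomputable def quadTest (n : ℕ) (θ : ℝ → ℝ) (q₀ : EuclideanSpace ℝ (Fin n) × ℝ)
    (g : SpaceTime n) (A : SpaceTime n →L[ℝ] SpaceTime n)
    (q : EuclideanSpace ℝ (Fin n) × ℝ) : ℝ :=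
  θ q.2 + ⟪g, toSpaceTime n (q - q₀)⟫ +
    1 / 2 * ⟪A (toSpaceTime n (q - q₀)), toSpaceTime n (q - q₀)⟫

lemma paraTestFn_quadTest (n : ℕ) {θ : ℝ → ℝ} (hθ : ContDiff ℝ 2 θ)
    (q₀ : EuclideanSpace ℝ (Fin n) × ℝ) (g : SpaceTime n) (A : SpaceTime n →L[ℝ] SpaceTime n) :
    ParaTestFn n (quadTest n θ q₀ g A) := by
  have h : ContDiff ℝ 2 (quadTest n θ q₀ g A) := by
    unfold quadTest
    have hL : ContDiff ℝ 2 fun q : EuclideanSpace ℝ (Fin n) × ℝ => toSpaceTime n (q - q₀) :=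
      (toSpaceTime n).contDiff.comp (contDiff_id.sub contDiff_const)
    exact ((hθ.comp contDiff_snd).add (contDiff_const.inner ℝ hL)).add
      (contDiff_const.mul ((A.contDiff.comp hL).inner ℝ hL))
  exact ⟨fun t => h.comp (contDiff_id.prodMk contDiff_const),
    fun x => (h.of_le (by norm_num)).comp (contDiff_const.prodMk contDiff_id)⟩

lemma quadTest_space (n : ℕ) (p : ℝ) (θ : ℝ → ℝ) (q₀ : EuclideanSpace ℝ (Fin n) × ℝ)
    (g : SpaceTime n) (A : SpaceTime n →L[ℝ] SpaceTime n) :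
    pSpaceLap n p (quadTest n θ q₀ g A) q₀ +
      (p - 1) * ‖gradient (fun x => quadTest n θ q₀ g A (x, q₀.2)) q₀.1‖ ^ p =
      gpOperator n p g.fst (spaceBlock n A) := by
  have h : (fun x => quadTest n θ q₀ g A (x, q₀.2)) = fun x => θ q₀.2 + ⟪g.fst, x - q₀.1⟫ +
      1 / 2 * ⟪spaceBlock n A (x - q₀.1), x - q₀.1⟫ := by
    ext x
    have hd : (x, q₀.2) - q₀ = (x - q₀.1, 0) := by ext <;> simp
    simp only [quadTest, hd]
    simp [spaceBlock, WithLp.prod_inner_apply, -map_sub, -WithLp.toLp_sub]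
  unfold pSpaceLap
  rw [h]
  exact pLap_quadratic n p _ _ _ _

lemma timeDeriv_quadTest (n : ℕ) {θ : ℝ → ℝ} (hθ : Differentiable ℝ θ)
    (q₀ : EuclideanSpace ℝ (Fin n) × ℝ) (g : SpaceTime n) (A : SpaceTime n →L[ℝ] SpaceTime n) :
    timeDeriv n (quadTest n θ q₀ g A) q₀ = deriv θ q₀.2 + g.snd := by
  set j := toSpaceTime n (0, 1) with hj
  have hL : ∀ t, toSpaceTime n ((q₀.1, t) - q₀) = (t - q₀.2) • j := by
    intro t
    rw [hj, ← map_smul]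
    congr 1
    ext <;> simp
  have hgj : ⟪g, j⟫ = g.snd := by simp [hj, WithLp.prod_inner_apply]
  have h : (fun t => quadTest n θ q₀ g A (q₀.1, t)) = fun t => θ t + (t - q₀.2) * g.snd +
      1 / 2 * ((t - q₀.2) ^ 2 * ⟪A j, j⟫) := by
    ext t
    simp only [quadTest, hL, map_smul, inner_smul_left, inner_smul_right, conj_trivial, hgj]
    ring
  unfold timeDeriv
  rw [h]
  have hid : HasDerivAt (fun t => t - q₀.2) 1 q₀.2 := (hasDerivAt_id _).sub_const _
  have h1 := (((hθ q₀.2).hasDerivAt).add (hid.mul_const g.snd)).add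
    (((hid.pow 2).mul_const ⟪A j, j⟫).const_mul (1 / 2))
  exact (h1.congr_deriv (by simp)).deriv

lemma GpSub.of_jet {n : ℕ} {p : ℝ} {Q : Set (EuclideanSpace ℝ (Fin n) × ℝ)}
    {u : EuclideanSpace ℝ (Fin n) × ℝ → ℝ} (hu : GpSub n p Q u) {θ : ℝ → ℝ} (hθ : ContDiff ℝ 2 θ)
    {q₀ : EuclideanSpace ℝ (Fin n) × ℝ} (hq₀ : q₀ ∈ Q) {g : SpaceTime n}
    {A : SpaceTime n →L[ℝ] SpaceTime n}
    (h : ∀ᶠ q in 𝓝[Q] q₀, u q - θ q.2 ≤ u q₀ - θ q₀.2 + ⟪g, toSpaceTime n (q - q₀)⟫ +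
      1 / 2 * ⟪A (toSpaceTime n (q - q₀)), toSpaceTime n (q - q₀)⟫) :
    0 ≤ gpOperator n p g.fst (spaceBlock n A) - (p - 1) * (deriv θ q₀.2 + g.snd) := by
  rw [← quadTest_space n p θ q₀, ← timeDeriv_quadTest n (hθ.differentiable (by norm_num)) q₀ g A]
  refine hu _ (paraTestFn_quadTest n hθ q₀ g A) q₀ hq₀ ?_
  filter_upwards [h] with q hq
  simp only [quadTest, sub_self, map_zero, inner_zero_right] at hq ⊢
  linarith

lemma GpSuper.of_jet {n : ℕ} {p : ℝ} {Q : Set (EuclideanSpace ℝ (Fin n) × ℝ)}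
    {v : EuclideanSpace ℝ (Fin n) × ℝ → ℝ} (hv : GpSuper n p Q v)
    {q₀ : EuclideanSpace ℝ (Fin n) × ℝ} (hq₀ : q₀ ∈ Q) {g : SpaceTime n}
    {A : SpaceTime n →L[ℝ] SpaceTime n}
    (h : ∀ᶠ q in 𝓝[Q] q₀, v q₀ + ⟪g, toSpaceTime n (q - q₀)⟫ +
      1 / 2 * ⟪A (toSpaceTime n (q - q₀)), toSpaceTime n (q - q₀)⟫ ≤ v q) :
    gpOperator n p g.fst (spaceBlock n A) - (p - 1) * g.snd ≤ 0 := by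
  have h0 : g.snd = deriv (fun _ : ℝ => (0 : ℝ)) q₀.2 + g.snd := by simp
  rw [h0, ← quadTest_space n p (fun _ => 0) q₀,
    ← timeDeriv_quadTest n (differentiable_const (0 : ℝ)) q₀ g A]
  refine hv _ (paraTestFn_quadTest n contDiff_const q₀ g A) q₀ hq₀ ?_
  filter_upwards [h] with q hq
  simp only [quadTest, sub_self, map_zero, inner_zero_right] at hq ⊢
  linarith

section AddScalar

variable {X : Type*} [NormedAddCommGroup X] [InnerProductSpace ℝ X]

/-- The operator whose quadratic form is that of `A` plus `2 δ ‖·‖²`. -/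
noncomputable def addScalar (A : X →L[ℝ] X) (δ : ℝ) : X →L[ℝ] X :=
  A + (2 * δ) • ContinuousLinearMap.id ℝ X

lemma addScalar_zero (A : X →L[ℝ] X) : addScalar A 0 = A := by simp [addScalar]

lemma inner_addScalar_self (A : X →L[ℝ] X) (δ : ℝ) (e : X) :
    ⟪addScalar A δ e, e⟫ = ⟪A e, e⟫ + 2 * δ * ‖e‖ ^ 2 := by
  simp [addScalar, inner_add_left, inner_smul_left]

lemma Continuous.addScalar {Y : Type*} [TopologicalSpace Y] {A : Y → X →L[ℝ] X} {δ : Y → ℝ}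
    (hA : Continuous A) (hδ : Continuous δ) : Continuous fun z => addScalar (A z) (δ z) :=
  hA.add ((continuous_const.mul hδ).smul continuous_const)

end AddScalar

/-- The difference of the operator `G_p` on the two jets of a doubled maximum, with the Hessians
relaxed by `2 δ`. -/
noncomputable def jetGap (n : ℕ) (p lam δ : ℝ) (P x y : SpaceTime n)
    (A : SpaceTime n →L[ℝ] SpaceTime n) : ℝ :=
  gpOperator n p ((lam / 2) • (x - y) + (1 / 2 : ℝ) • P).fst
      (spaceBlock n (addScalar A δ)) -
    gpOperator n p ((lam / 2) • (x - y) - (1 / 2 : ℝ) • P).fst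
      (spaceBlock n (addScalar A (-δ))) -
    (p - 1) * P.snd

lemma continuous_jetGap (n : ℕ) {p : ℝ} (hp : 2 ≤ p) (lam : ℝ) :
    Continuous fun z : ℝ × SpaceTime n × SpaceTime n × SpaceTime n ×
      (SpaceTime n →L[ℝ] SpaceTime n) => jetGap n p lam z.1 z.2.1 z.2.2.1 z.2.2.2.1 z.2.2.2.2 := by
  have hF := continuous_gpOperator n hp
  have hB := continuous_spaceBlock n
  have hfst : Continuous fun z : SpaceTime n => z.fst := by fun_prop
  have hsnd : Continuous fun z : SpaceTime n => z.snd := by fun_prop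
  unfold jetGap
  have hg₁ : Continuous fun z : ℝ × SpaceTime n × SpaceTime n × SpaceTime n ×
      (SpaceTime n →L[ℝ] SpaceTime n) =>
      (lam / 2) • (z.2.2.1 - z.2.2.2.1) + (1 / 2 : ℝ) • z.2.1 := by fun_prop
  have hg₂ : Continuous fun z : ℝ × SpaceTime n × SpaceTime n × SpaceTime n ×
      (SpaceTime n →L[ℝ] SpaceTime n) =>
      (lam / 2) • (z.2.2.1 - z.2.2.2.1) - (1 / 2 : ℝ) • z.2.1 := by fun_prop
  have hA : Continuous fun z : ℝ × SpaceTime n × SpaceTime n × SpaceTime n ×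
      (SpaceTime n →L[ℝ] SpaceTime n) => z.2.2.2.2 := by fun_prop
  exact ((hF.comp ((hfst.comp hg₁).prodMk (hB.comp (hA.addScalar continuous_fst)))).sub
    (hF.comp ((hfst.comp hg₂).prodMk (hB.comp (hA.addScalar continuous_fst.neg))))).sub
    (continuous_const.mul (hsnd.comp (continuous_fst.comp continuous_snd)))

/-- The gap between the two jets of a doubled maximum cannot stay bounded below by a positive
number as the perturbations vanish. -/
lemma nonpos_of_le_jetGap (n : ℕ) {p : ℝ} (hp : 2 ≤ p) {S : Set (SpaceTime n)} (hS : IsCompact S)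
    {lam M c : ℝ}
    (h : ∀ k : ℕ, ∃ (P x y : SpaceTime n) (A : SpaceTime n →L[ℝ] SpaceTime n),
      ‖P‖ ≤ 1 / ((k : ℝ) + 1) ∧ x ∈ S ∧ y ∈ S ∧ ‖A‖ ≤ M ∧
      c ≤ jetGap n p lam (1 / ((k : ℝ) + 1)) P x y A) : c ≤ 0 := by
  choose P x y A hP hx hy hA hc using h
  have : ProperSpace (SpaceTime n →L[ℝ] SpaceTime n) := FiniteDimensional.proper ℝ _
  have hK : IsCompact (S ×ˢ S ×ˢ Metric.closedBall (0 : SpaceTime n →L[ℝ] SpaceTime n) M) :=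
    hS.prod (hS.prod (isCompact_closedBall _ _))
  obtain ⟨⟨x₀, y₀, A₀⟩, -, φ, hφ, hlim⟩ := hK.tendsto_subseq
    (x := fun k => (x k, y k, A k)) fun k => ⟨hx k, hy k, by simpa using hA k⟩
  have hδ : Tendsto (fun k : ℕ => 1 / (((φ k : ℕ) : ℝ) + 1)) atTop (𝓝 0) :=
    tendsto_one_div_add_atTop_nhds_zero_nat.comp hφ.tendsto_atTop
  have hP0 : Tendsto (fun k => P (φ k)) atTop (𝓝 0) :=
    squeeze_zero_norm (fun k => hP (φ k)) hδ
  have ht := ((continuous_jetGap n hp lam).tendsto (0, 0, x₀, y₀, A₀)).comp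
    (hδ.prodMk_nhds (hP0.prodMk_nhds hlim))
  have hz : jetGap n p lam 0 0 x₀ y₀ A₀ = 0 := by simp [jetGap, addScalar_zero]
  dsimp only at ht
  rw [hz] at ht
  exact ge_of_tendsto' ht fun k => hc (φ k)

/-- An upper second-order expansion in space-time gives the subsolution inequality, with the
Hessian shifted by the error term. -/
lemma GpSub.of_expansion {n : ℕ} {p : ℝ} {Q : Set (EuclideanSpace ℝ (Fin n) × ℝ)}
    {u : EuclideanSpace ℝ (Fin n) × ℝ → ℝ} (hu : GpSub n p Q u) {θ : ℝ → ℝ} (hθ : ContDiff ℝ 2 θ)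
    {S : Set (SpaceTime n)} {x g : SpaceTime n} {A : SpaceTime n →L[ℝ] SpaceTime n} {δ : ℝ}
    (hx : (toSpaceTime n).symm x ∈ Q) (hS : S ∈ 𝓝 x)
    (h : ∀ᶠ e in 𝓝 (0 : SpaceTime n), x + e ∈ S →
      u ((toSpaceTime n).symm (x + e)) - θ ((toSpaceTime n).symm (x + e)).2 ≤
        u ((toSpaceTime n).symm x) - θ ((toSpaceTime n).symm x).2 + ⟪g, e⟫ + 1 / 2 * ⟪A e, e⟫ +
          δ * ‖e‖ ^ 2) :
    (p - 1) * (deriv θ ((toSpaceTime n).symm x).2 + g.snd) ≤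
      gpOperator n p g.fst (spaceBlock n (addScalar A δ)) := by
  refine sub_nonneg.1 (hu.of_jet hθ hx (mem_nhdsWithin_of_mem_nhds ?_))
  have h1 : Tendsto (fun q => toSpaceTime n (q - (toSpaceTime n).symm x))
      (𝓝 ((toSpaceTime n).symm x)) (𝓝 0) :=
    Continuous.tendsto' (by fun_prop) _ _ (by simp)
  have h2 : Tendsto (toSpaceTime n) (𝓝 ((toSpaceTime n).symm x)) (𝓝 x) :=
    (toSpaceTime n).continuous.tendsto' _ _ (by simp)
  filter_upwards [h1.eventually h, h2.eventually hS] with q hq hqS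
  have hxq : x + toSpaceTime n (q - (toSpaceTime n).symm x) = toSpaceTime n q := by
    rw [map_sub, ContinuousLinearEquiv.apply_symm_apply, add_sub_cancel]
  rw [hxq, ContinuousLinearEquiv.symm_apply_apply] at hq
  refine (hq hqS).trans_eq ?_
  generalize toSpaceTime n (q - (toSpaceTime n).symm x) = e
  rw [inner_addScalar_self]
  ring

/-- A lower second-order expansion in space-time gives the supersolution inequality, with the
Hessian shifted by the error term. -/
lemma GpSuper.of_expansion {n : ℕ} {p : ℝ} {Q : Set (EuclideanSpace ℝ (Fin n) × ℝ)}
    {v : EuclideanSpace ℝ (Fin n) × ℝ → ℝ} (hv : GpSuper n p Q v)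
    {S : Set (SpaceTime n)} {x g : SpaceTime n} {A : SpaceTime n →L[ℝ] SpaceTime n} {δ : ℝ}
    (hx : (toSpaceTime n).symm x ∈ Q) (hS : S ∈ 𝓝 x)
    (h : ∀ᶠ e in 𝓝 (0 : SpaceTime n), x + e ∈ S →
      v ((toSpaceTime n).symm x) + ⟪g, e⟫ + 1 / 2 * ⟪A e, e⟫ - δ * ‖e‖ ^ 2 ≤
        v ((toSpaceTime n).symm (x + e))) :
    gpOperator n p g.fst (spaceBlock n (addScalar A (-δ))) ≤
      (p - 1) * g.snd := by
  refine sub_nonpos.1 (hv.of_jet hx (mem_nhdsWithin_of_mem_nhds ?_))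
  have h1 : Tendsto (fun q => toSpaceTime n (q - (toSpaceTime n).symm x))
      (𝓝 ((toSpaceTime n).symm x)) (𝓝 0) :=
    Continuous.tendsto' (by fun_prop) _ _ (by simp)
  have h2 : Tendsto (toSpaceTime n) (𝓝 ((toSpaceTime n).symm x)) (𝓝 x) :=
    (toSpaceTime n).continuous.tendsto' _ _ (by simp)
  filter_upwards [h1.eventually h, h2.eventually hS] with q hq hqS
  have hxq : x + toSpaceTime n (q - (toSpaceTime n).symm x) = toSpaceTime n q := by
    rw [map_sub, ContinuousLinearEquiv.apply_symm_apply, add_sub_cancel]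
  rw [hxq, ContinuousLinearEquiv.symm_apply_apply] at hq
  refine Eq.trans_le ?_ (hq hqS)
  generalize toSpaceTime n (q - (toSpaceTime n).symm x) = e
  rw [inner_addScalar_self]
  ring

/-- Comparison on a compact space-time set: a subsolution made strict by subtracting a function of
time with positive derivative cannot exceed a supersolution inside if it does not on the rest. -/
lemma GpSub.sub_le_of_strict {n : ℕ} {p : ℝ} (hp : 2 ≤ p)
    {Q S O : Set (EuclideanSpace ℝ (Fin n) × ℝ)} {u v : EuclideanSpace ℝ (Fin n) × ℝ → ℝ}
    (hu : GpSub n p Q u) (hv : GpSuper n p Q v) (hS : IsCompact S) (hO : IsOpen O) (hOS : O ⊆ S)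
    (hOQ : O ⊆ Q) (husc : UpperSemicontinuousOn u S) (hlsc : LowerSemicontinuousOn v S)
    {θ : ℝ → ℝ} (hθ : ContDiff ℝ 2 θ) {c : ℝ} (hc : 0 < c) (hθc : ∀ q ∈ O, c ≤ deriv θ q.2)
    (hle : ∀ q ∈ S, q ∉ O → u q - θ q.2 ≤ v q) {q₀ : EuclideanSpace ℝ (Fin n) × ℝ}
    (hq₀ : q₀ ∈ S) : u q₀ - θ q₀.2 ≤ v q₀ := by
  by_contra! hlt
  let L := toSpaceTime n
  have hmaps : MapsTo L.symm (L.symm ⁻¹' S) S := fun _ h => h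
  have hS' : IsCompact (L.symm ⁻¹' S) := L.symm.toHomeomorph.isCompact_preimage.2 hS
  have hO' : IsOpen (L.symm ⁻¹' O) := hO.preimage L.symm.continuous
  have hU : UpperSemicontinuousOn (fun z => u (L.symm z) - θ (L.symm z).2) (L.symm ⁻¹' S) := by
    have h1 : UpperSemicontinuousOn (fun z => u (L.symm z)) (L.symm ⁻¹' S) :=
      husc.comp L.symm.continuous.continuousOn hmaps
    have h2 : Continuous fun z => -θ (L.symm z).2 :=
      (hθ.continuous.comp (continuous_snd.comp L.symm.continuous)).neg
    simpa only [sub_eq_add_neg] using h1.add (h2.upperSemicontinuous.upperSemicontinuousOn _)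
  have hV : LowerSemicontinuousOn (fun z => v (L.symm z)) (L.symm ⁻¹' S) :=
    hlsc.comp L.symm.continuous.continuousOn hmaps
  have hmem₀ : L q₀ ∈ L.symm ⁻¹' S := by simpa using hq₀
  obtain ⟨lam, hlam, r, hr, hdbl⟩ := exists_isDoublingMax_mem hS' hO' hU hV
    (fun z hz hzO => hle _ hz hzO) hmem₀ (by simpa using hlt)
  suffices h : (p - 1) * c ≤ 0 by nlinarith
  refine nonpos_of_le_jetGap n hp hS' (lam := lam) (M := 5 * lam) fun k => ?_
  have hk : 0 < 1 / ((k : ℝ) + 1) := by positivity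
  obtain ⟨P, x, y, A, hP, hxy, hA, hux, hvy⟩ :=
    exists_jets hS' ⟨_, hmem₀⟩ hU hV hlam (lt_min hr hk)
  obtain ⟨hxO, hyO⟩ := hdbl P x y (hP.trans_le (min_le_left _ _)) hxy
  have hsub : L.symm ⁻¹' O ⊆ L.symm ⁻¹' S := preimage_mono hOS
  have h1 := hu.of_expansion hθ (hOQ hxO)
    (Filter.mem_of_superset (hO'.mem_nhds hxO) hsub) (hux _ hk)
  have h2 := hv.of_expansion (hOQ hyO)
    (Filter.mem_of_superset (hO'.mem_nhds hyO) hsub) (hvy _ hk)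
  refine ⟨P, x, y, A, hP.le.trans (min_le_right _ _), hxy.1, hxy.2.1, hA, ?_⟩
  have h3 := hθc _ hxO
  simp only [WithLp.add_snd, WithLp.sub_snd, WithLp.smul_snd, smul_eq_mul] at h1 h2
  have h4 : (p - 1) * c ≤ (p - 1) * deriv θ (L.symm x).2 :=
    mul_le_mul_of_nonneg_left h3 (by linarith)
  unfold jetGap
  linarith

end Parabolic

/-- Theorem 2.4 (Comparison principle for `G_p`): if `G_p u ≥ 0`, `G_p v ≤ 0`, `u, v` bounded
and `u ≤ v` on the parabolic boundary, then `u ≤ v` in the cylinder. -/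
theorem stmt6 (n : ℕ) (hn : 2 ≤ n) (p : ℝ) (hp : 2 ≤ p)
    (Ω : Set (EuclideanSpace ℝ (Fin n))) (hΩo : IsOpen Ω) (hΩc : IsConnected Ω)
    (hΩb : Bornology.IsBounded Ω)
    (T : ℝ) (hT : 0 < T)
    (u v : EuclideanSpace ℝ (Fin n) × ℝ → ℝ)
    (husc : UpperSemicontinuousOn u (pcyl n Ω (Set.Ioo 0 T) ∪ pbdry n Ω (Set.Ioo 0 T)))
    (hlsc : LowerSemicontinuousOn v (pcyl n Ω (Set.Ioo 0 T) ∪ pbdry n Ω (Set.Ioo 0 T)))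
    (hsub : GpSub n p (pcyl n Ω (Set.Ioo 0 T)) u)
    (hsuper : GpSuper n p (pcyl n Ω (Set.Ioo 0 T)) v)
    (hbdd : ∃ C : ℝ, ∀ q ∈ pcyl n Ω (Set.Ioo 0 T) ∪ pbdry n Ω (Set.Ioo 0 T),
      |u q| ≤ C ∧ |v q| ≤ C)
    (hle : ∀ q ∈ pbdry n Ω (Set.Ioo 0 T), u q ≤ v q) :
    ∀ q ∈ pcyl n Ω (Set.Ioo 0 T), u q ≤ v q := by
  obtain ⟨C, hC⟩ := hbdd
  rintro ⟨x₀, t₀⟩ ⟨hx₀, ht₀, ht₀T⟩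
  dsimp only at hx₀ ht₀ ht₀T
  by_contra! hlt
  have hC0 : 0 ≤ C := (abs_nonneg _).trans (hC (x₀, t₀) (Or.inl ⟨hx₀, ht₀, ht₀T⟩)).1
  set η := (u (x₀, t₀) - v (x₀, t₀)) / 2 with hη
  have hη0 : 0 < η := by linarith
  obtain ⟨T', ht₀T', hT'T⟩ := exists_between ht₀T
  set k := 2 * C / (η * (T' - t₀)) + 1 with hk
  have hd : 0 < T' - t₀ := sub_pos.2 ht₀T'
  have hk0 : 0 < k := by positivity
  let θ : ℝ → ℝ := fun t => η * Real.exp (k * (t - t₀))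
  have hθ : ContDiff ℝ 2 θ := by fun_prop
  have hθ0 : ∀ t, 0 ≤ θ t := fun t => by positivity
  have hθ' : ∀ t, deriv θ t = η * (k * Real.exp (k * (t - t₀))) := by
    intro t
    have h := ((((hasDerivAt_id t).sub_const t₀).const_mul k).exp).const_mul η
    exact (h.congr_deriv (by simp [mul_comm])).deriv
  have hθT : 2 * C ≤ θ T' := by
    have h1 := Real.add_one_le_exp (k * (T' - t₀))
    have h2 : η * (k * (T' - t₀)) = 2 * C + η * (T' - t₀) := by
      rw [hk]; field_simp
    calc 2 * C ≤ η * (k * (T' - t₀)) := by rw [h2]; nlinarith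
      _ ≤ θ T' := mul_le_mul_of_nonneg_left (by linarith) hη0.le
  have hSD : closure Ω ×ˢ Set.Icc 0 T' ⊆ pcyl n Ω (Set.Ioo 0 T) ∪ pbdry n Ω (Set.Ioo 0 T) := by
    rintro ⟨x, t⟩ ⟨hx, h0t, htT'⟩
    dsimp only at hx h0t htT'
    rcases h0t.eq_or_lt with rfl | h0t
    · exact Or.inr (Or.inl ⟨hx, rfl⟩)
    have ht : t ∈ Set.Ioo 0 T := ⟨h0t, htT'.trans_lt hT'T⟩
    by_cases hxΩ : x ∈ Ω
    · exact Or.inl ⟨hxΩ, ht⟩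
    · exact Or.inr (Or.inr ⟨⟨hx, by rwa [hΩo.interior_eq]⟩, ht⟩)
  have hmain := hsub.sub_le_of_strict hp hsuper (S := closure Ω ×ˢ Set.Icc 0 T')
    (O := Ω ×ˢ Set.Ioo 0 T') (hΩb.isCompact_closure.prod isCompact_Icc)
    (hΩo.prod isOpen_Ioo) (prod_mono subset_closure Set.Ioo_subset_Icc_self)
    (prod_mono le_rfl (Set.Ioo_subset_Ioo_right hT'T.le)) (husc.mono hSD) (hlsc.mono hSD) hθ
    (c := η * (k * Real.exp (k * (0 - t₀)))) (by positivity) ?_ ?_ (q₀ := (x₀, t₀))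
    ⟨subset_closure hx₀, ht₀.le, ht₀T'.le⟩
  · simp only [θ, sub_self, mul_zero, Real.exp_zero, mul_one] at hmain
    linarith
  · rintro ⟨x, t⟩ ⟨-, h0t, -⟩
    dsimp only at h0t
    rw [hθ']
    gcongr
  · rintro ⟨x, t⟩ hq hqO
    dsimp only
    rcases hq.2.2.eq_or_lt with h | h
    · have h1 := hC _ (hSD hq)
      dsimp only at h
      rw [h] at h1 ⊢
      linarith [(abs_le.1 h1.1).2, (abs_le.1 h1.2).1]
    · have hb : (x, t) ∈ pbdry n Ω (Set.Ioo 0 T) := by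
        refine (hSD hq).resolve_left fun hc => hqO ⟨hc.1, hc.2.1, h⟩
      linarith [hle _ hb, hθ0 t]
end

section
/- Let 2 ≤ p < ∞, let Ω ⊂ ℝⁿ (n ≥ 2) be a domain, T > 0, and let u : Ω_T → (0,∞) and v : Ω_T → ℝ be related by u = e^v. Then u is upper semicontinuous on Ω_T ∪ P_T and a viscosity subsolution of Γ_p u = 0 in Ω_T if and only if v is upper semicontinuous on Ω_T ∪ P_T and a viscosity subsolution of G_p v = 0 in Ω_T; likewise u is lower semicontinuous and a viscosity supersolution of Γ_p u = 0 if and only if v is lower semicontinuous and a viscosity supersolution of G_p v = 0. -/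
open Set Filter
open scoped Classical

/-- The second derivative of a composition with a scalar function. -/
theorem iteratedFDeriv_two_scalar_comp {V : Type*} [NormedAddCommGroup V] [NormedSpace ℝ V]
    {F : ℝ → ℝ} {φ : V → ℝ} (hF : ContDiff ℝ 2 F) (hφ : ContDiff ℝ 2 φ) (x : V) (m : Fin 2 → V) :
    iteratedFDeriv ℝ 2 (fun y => F (φ y)) x m =
      deriv (deriv F) (φ x) * fderiv ℝ φ x (m 0) * fderiv ℝ φ x (m 1) +
        deriv F (φ x) * iteratedFDeriv ℝ 2 φ x m := by
  have hFd : Differentiable ℝ F := hF.differentiable (by norm_num)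
  have hφd : Differentiable ℝ φ := hφ.differentiable (by norm_num)
  have hF1 : Differentiable ℝ (deriv F) :=
    ((contDiff_succ_iff_deriv (n := 1)).1 hF).2.2.differentiable (by norm_num)
  have hφ1 : Differentiable ℝ (fderiv ℝ φ) :=
    (hφ.fderiv_right (m := 1) (by norm_num)).differentiable (by norm_num)
  have h1 : fderiv ℝ (fun y => F (φ y)) = fun y => deriv F (φ y) • fderiv ℝ φ y := by
    funext y
    exact ((hFd (φ y)).hasDerivAt.comp_hasFDerivAt y (hφd y).hasFDerivAt).fderiv
  have h2 := ((hF1 (φ x)).hasDerivAt.comp_hasFDerivAt x (hφd x).hasFDerivAt).smul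
    (hφ1 x).hasFDerivAt
  rw [iteratedFDeriv_two_apply, iteratedFDeriv_two_apply, h1]
  have h3 : fderiv ℝ (fun y => deriv F (φ y) • fderiv ℝ φ y) x = _ := h2.fderiv
  rw [h3]
  simp [mul_assoc]
  ring

theorem gradient_scalar_comp {V : Type*} [NormedAddCommGroup V] [InnerProductSpace ℝ V]
    [CompleteSpace V] {F : ℝ → ℝ} {φ : V → ℝ} {x : V} (hF : DifferentiableAt ℝ F (φ x))
    (hφ : DifferentiableAt ℝ φ x) :
    gradient (fun y => F (φ y)) x = deriv F (φ x) • gradient φ x := by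
  have h : fderiv ℝ (fun y => F (φ y)) x = deriv F (φ x) • fderiv ℝ φ x :=
    (hF.hasDerivAt.comp_hasFDerivAt x hφ.hasFDerivAt).fderiv
  simp [gradient, h]

theorem fderiv_apply_gradient {V : Type*} [NormedAddCommGroup V] [InnerProductSpace ℝ V]
    [CompleteSpace V] (φ : V → ℝ) (x : V) :
    fderiv ℝ φ x (gradient φ x) = ‖gradient φ x‖ ^ 2 := by
  rw [← real_inner_self_eq_norm_sq]
  conv_rhs => enter [2]; unfold gradient
  rw [← InnerProductSpace.toDual_apply_apply (𝕜 := ℝ)]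
  simp [gradient]

theorem sum_fderiv_single_sq {n : ℕ} (φ : EuclideanSpace ℝ (Fin n) → ℝ) (x : EuclideanSpace ℝ (Fin n)) :
    ∑ i : Fin n, fderiv ℝ φ x (EuclideanSpace.single i (1 : ℝ)) ^ 2 = ‖gradient φ x‖ ^ 2 := by
  rw [EuclideanSpace.real_norm_sq_eq]
  refine Finset.sum_congr rfl fun i _ => ?_
  have h : fderiv ℝ φ x (EuclideanSpace.single i (1 : ℝ)) =
      inner ℝ (gradient φ x) (EuclideanSpace.single i (1 : ℝ)) := by
    rw [← InnerProductSpace.toDual_apply_apply (𝕜 := ℝ)]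
    simp [gradient]
  rw [h, EuclideanSpace.inner_single_right]
  simp

/-- The chain rule for the p-Laplacian under an increasing change of the dependent variable. -/
theorem pLap_scalar_comp {n : ℕ} {p : ℝ} (hp : 2 ≤ p) {F : ℝ → ℝ} {φ : EuclideanSpace ℝ (Fin n) → ℝ}
    (hF : ContDiff ℝ 2 F) (hφ : ContDiff ℝ 2 φ) (x : EuclideanSpace ℝ (Fin n)) {d e : ℝ} (hd : 0 < d)
    (h1 : deriv F (φ x) = d) (h2 : deriv (deriv F) (φ x) = e) :
    pLap n p (fun y => F (φ y)) x =
      d ^ (p - 1) * pLap n p φ x + (p - 1) * e * d ^ (p - 2) * ‖gradient φ x‖ ^ p := by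
  have hg : gradient (fun y => F (φ y)) x = d • gradient φ x := by
    rw [gradient_scalar_comp (hF.differentiable (by norm_num) _)
      (hφ.differentiable (by norm_num) _), h1]
  have htr : ∑ i : Fin n, iteratedFDeriv ℝ 2 (fun y => F (φ y)) x
        ![EuclideanSpace.single i (1 : ℝ), EuclideanSpace.single i (1 : ℝ)] =
      e * ‖gradient φ x‖ ^ 2 + d * ∑ i : Fin n, iteratedFDeriv ℝ 2 φ x
        ![EuclideanSpace.single i (1 : ℝ), EuclideanSpace.single i (1 : ℝ)] := by
    rw [← sum_fderiv_single_sq, Finset.mul_sum, Finset.mul_sum, ← Finset.sum_add_distrib]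
    refine Finset.sum_congr rfl fun i _ => ?_
    rw [iteratedFDeriv_two_scalar_comp hF hφ, h1, h2]
    simp
    ring
  have hp0 : p ≠ 0 := by linarith
  unfold pLap
  rw [htr, hg]
  by_cases h0 : gradient φ x = 0
  · simp only [h0, smul_zero, if_true, norm_zero, Real.zero_rpow hp0]
    by_cases hp2 : p = 2
    · subst hp2
      norm_num
    · simp [hp2]
  · have hN : 0 < ‖gradient φ x‖ := norm_pos_iff.2 h0
    have hq : iteratedFDeriv ℝ 2 (fun y => F (φ y)) x ![d • gradient φ x, d • gradient φ x] =
        d ^ 2 * (e * ‖gradient φ x‖ ^ 4 +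
          d * iteratedFDeriv ℝ 2 φ x ![gradient φ x, gradient φ x]) := by
      rw [iteratedFDeriv_two_scalar_comp hF hφ, h1, h2, iteratedFDeriv_two_apply,
        iteratedFDeriv_two_apply]
      simp [fderiv_apply_gradient]
      ring
    rw [if_neg (smul_ne_zero hd.ne' h0), if_neg h0, hq, norm_smul, Real.norm_of_nonneg hd.le,
      Real.mul_rpow hd.le hN.le, Real.mul_rpow hd.le hN.le]
    have e1 : d ^ (p - 1) = d ^ (p - 4) * d ^ 3 := by
      rw [← Real.rpow_natCast, ← Real.rpow_add hd]
      congr 1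
      norm_num
      ring
    have e2 : d ^ (p - 2) = d ^ (p - 4) * d ^ 2 := by
      rw [← Real.rpow_natCast, ← Real.rpow_add hd]
      congr 1
      norm_num
      ring
    have e3 : ‖gradient φ x‖ ^ p = ‖gradient φ x‖ ^ (p - 4) * ‖gradient φ x‖ ^ 4 := by
      rw [← Real.rpow_natCast, ← Real.rpow_add hN]
      congr 1
      norm_num
    have e4 : ‖gradient φ x‖ ^ (p - 2) = ‖gradient φ x‖ ^ (p - 4) * ‖gradient φ x‖ ^ 2 := by
      rw [← Real.rpow_natCast, ← Real.rpow_add hN]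
      congr 1
      norm_num
      ring
    rw [e1, e2, e3, e4]
    ring

theorem ParaTestFn.scalar_comp {n : ℕ} {ψ : EuclideanSpace ℝ (Fin n) × ℝ → ℝ} (hψ : ParaTestFn n ψ) {F : ℝ → ℝ}
    (hF : ContDiff ℝ 2 F) : ParaTestFn n fun z => F (ψ z) :=
  ⟨fun t => hF.comp (hψ.1 t), fun x => (hF.of_le (by norm_num)).comp (hψ.2 x)⟩

theorem ParaTestFn.timeDeriv_scalar_comp {n : ℕ} {ψ : EuclideanSpace ℝ (Fin n) × ℝ → ℝ} (hψ : ParaTestFn n ψ)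
    {F : ℝ → ℝ} (hF : ContDiff ℝ 2 F) (q : EuclideanSpace ℝ (Fin n) × ℝ) :
    timeDeriv n (fun z => F (ψ z)) q = deriv F (ψ q) * timeDeriv n ψ q :=
  ((hF.differentiable (by norm_num) _).hasDerivAt.comp q.2
    ((hψ.2 q.1).differentiable (by norm_num) q.2).hasDerivAt).deriv

/-- The operator `Γ_p` on a function with the second-order jet of the exponential of a
test function. -/
theorem trudinger_of_exp_jet {n : ℕ} {p : ℝ} (hp : 2 ≤ p) {ψ : EuclideanSpace ℝ (Fin n) × ℝ → ℝ}
    (hψ : ParaTestFn n ψ) {F : ℝ → ℝ} (hF : ContDiff ℝ 2 F) (q : EuclideanSpace ℝ (Fin n) × ℝ) {c : ℝ} (hc : 0 < c)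
    (h1 : deriv F (ψ q) = c) (h2 : deriv (deriv F) (ψ q) = c) :
    pSpaceLap n p (fun z => F (ψ z)) q - (p - 1) * c ^ (p - 2) * timeDeriv n (fun z => F (ψ z)) q =
      c ^ (p - 1) * (pSpaceLap n p ψ q + (p - 1) * ‖gradient (fun x => ψ (x, q.2)) q.1‖ ^ p -
        (p - 1) * timeDeriv n ψ q) := by
  have h : pSpaceLap n p (fun z => F (ψ z)) q = _ :=
    pLap_scalar_comp hp hF (hψ.1 q.2) q.1 hc h1 h2
  rw [h, hψ.timeDeriv_scalar_comp hF, h1]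
  have e1 : c ^ (p - 1) = c ^ (p - 2) * c := by
    rw [← Real.rpow_add_one hc.ne']
    congr 1
    ring
  rw [e1]
  unfold pSpaceLap
  ring

/-- The operator `G_p` on a function with the second-order jet of the logarithm of a test
function. -/
theorem gp_of_log_jet {n : ℕ} {p : ℝ} (hp : 2 ≤ p) {ψ : EuclideanSpace ℝ (Fin n) × ℝ → ℝ}
    (hψ : ParaTestFn n ψ) {F : ℝ → ℝ} (hF : ContDiff ℝ 2 F) (q : EuclideanSpace ℝ (Fin n) × ℝ) {c : ℝ} (hc : 0 < c)
    (h1 : deriv F (ψ q) = c⁻¹) (h2 : deriv (deriv F) (ψ q) = -c⁻¹ ^ 2) :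
    c ^ (p - 1) * (pSpaceLap n p (fun z => F (ψ z)) q +
        (p - 1) * ‖gradient (fun x => F (ψ (x, q.2))) q.1‖ ^ p -
        (p - 1) * timeDeriv n (fun z => F (ψ z)) q) =
      pSpaceLap n p ψ q - (p - 1) * c ^ (p - 2) * timeDeriv n ψ q := by
  have hci : 0 < c⁻¹ := inv_pos.2 hc
  have h : pSpaceLap n p (fun z => F (ψ z)) q = _ :=
    pLap_scalar_comp hp hF (hψ.1 q.2) q.1 hci h1 h2
  have hg : gradient (fun x => F (ψ (x, q.2))) q.1 = c⁻¹ • gradient (fun x => ψ (x, q.2)) q.1 := by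
    have := gradient_scalar_comp (x := q.1) (hF.differentiable (by norm_num) _)
      ((hψ.1 q.2).differentiable (by norm_num) q.1)
    rwa [h1] at this
  rw [h, hψ.timeDeriv_scalar_comp hF, h1, hg, norm_smul, Real.norm_of_nonneg hci.le,
    Real.mul_rpow hci.le (norm_nonneg _)]
  have e1 : c ^ (p - 1) = c ^ (p - 2) * c := by
    rw [← Real.rpow_add_one hc.ne']
    congr 1
    ring
  have e2 : c⁻¹ ^ (p - 1) = c⁻¹ ^ (p - 2) * c⁻¹ := by
    rw [← Real.rpow_add_one hci.ne']
    congr 1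
    ring
  have e3 : c⁻¹ ^ p = c⁻¹ ^ (p - 2) * c⁻¹ ^ 2 := by
    rw [← Real.rpow_natCast, ← Real.rpow_add hci]
    congr 1
    norm_num
  have e4 : c⁻¹ ^ (p - 2) = (c ^ (p - 2))⁻¹ := Real.inv_rpow hc.le _
  have hcp : 0 < c ^ (p - 2) := Real.rpow_pos_of_pos hc _
  rw [e1, e2, e3, e4]
  unfold pSpaceLap
  field_simp
  ring

/-- The Taylor polynomial of `log` of order 4 with the quartic coefficient left free, based at
`c` and with the argument shifted by `a`. -/
noncomputable def logQuartic (K c a s : ℝ) : ℝ :=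
  Real.log c + c⁻¹ * (s - a) - c⁻¹ ^ 2 / 2 * (s - a) ^ 2 + c⁻¹ ^ 3 / 3 * (s - a) ^ 3 -
    K * c⁻¹ ^ 4 * (s - a) ^ 4

theorem contDiff_logQuartic (K c a : ℝ) : ContDiff ℝ 2 (logQuartic K c a) := by
  unfold logQuartic
  fun_prop

theorem deriv_logQuartic (K c a : ℝ) : deriv (logQuartic K c a) = fun s =>
    c⁻¹ - c⁻¹ ^ 2 * (s - a) + c⁻¹ ^ 3 * (s - a) ^ 2 - 4 * K * c⁻¹ ^ 4 * (s - a) ^ 3 := by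
  funext s
  have h : HasDerivAt (fun s => s - a) 1 s := (hasDerivAt_id s).sub_const a
  have := ((((h.const_mul c⁻¹).const_add (Real.log c)).sub
    ((h.pow 2).const_mul (c⁻¹ ^ 2 / 2))).add ((h.pow 3).const_mul (c⁻¹ ^ 3 / 3))).sub
    ((h.pow 4).const_mul (K * c⁻¹ ^ 4))
  refine this.deriv.trans ?_
  norm_num
  ring

theorem deriv_logQuartic_self (K c a : ℝ) : deriv (logQuartic K c a) a = c⁻¹ := by
  simp [deriv_logQuartic]

theorem deriv_deriv_logQuartic_self (K c a : ℝ) :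
    deriv (deriv (logQuartic K c a)) a = -c⁻¹ ^ 2 := by
  rw [deriv_logQuartic]
  have h : HasDerivAt (fun s => s - a) 1 a := (hasDerivAt_id a).sub_const a
  have := (((h.const_mul (c⁻¹ ^ 2)).const_sub c⁻¹).add ((h.pow 2).const_mul (c⁻¹ ^ 3))).sub
    ((h.pow 3).const_mul (4 * K * c⁻¹ ^ 4))
  refine this.deriv.trans ?_
  norm_num

theorem hasDerivAt_log_one_add_sub_quartic (K : ℝ) {x : ℝ} (hx : -1 < x) :
    HasDerivAt (fun x => Real.log (1 + x) - (x - x ^ 2 / 2 + x ^ 3 / 3 - K * x ^ 4))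
      (x ^ 3 * (4 * K - (1 + x)⁻¹)) x := by
  have h0 : (1 + x) ≠ 0 := by linarith
  have h := hasDerivAt_id x
  have := ((h.const_add 1).log h0).sub
    (((h.sub ((h.pow 2).div_const 2)).add ((h.pow 3).div_const 3)).sub ((h.pow 4).const_mul K))
  refine this.congr_deriv ?_
  simp
  field_simp
  ring

theorem log_one_add_le_cubic {x : ℝ} (hx : -1 < x) :
    Real.log (1 + x) ≤ x - x ^ 2 / 2 + x ^ 3 / 3 := by
  have hD := fun y (hy : y ∈ Ioi (-1 : ℝ)) => hasDerivAt_log_one_add_sub_quartic 0 hy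
  have hpos : ∀ y : ℝ, -1 < y → 0 < (1 + y)⁻¹ := fun y hy => inv_pos.2 (by linarith)
  suffices h : Real.log (1 + x) - (x - x ^ 2 / 2 + x ^ 3 / 3 - 0 * x ^ 4) ≤ 0 by linarith
  rcases le_total 0 x with h0 | h0
  · have hanti : AntitoneOn
        (fun x : ℝ => Real.log (1 + x) - (x - x ^ 2 / 2 + x ^ 3 / 3 - 0 * x ^ 4)) (Icc 0 x) := by
      refine antitoneOn_of_deriv_nonpos (convex_Icc 0 x)
        (fun y hy => (hD y (by linarith [hy.1] : -1 < y)).continuousAt.continuousWithinAt)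
        (fun y hy => ?_) (fun y hy => ?_) <;> rw [interior_Icc] at hy
      · exact (hD y (by linarith [hy.1] : -1 < y)).differentiableAt.differentiableWithinAt
      · have hy1 : -1 < y := by linarith [hy.1]
        rw [(hD y hy1).deriv]
        have h3 : 0 ≤ y ^ 3 := pow_nonneg hy.1.le 3
        nlinarith [hpos y hy1, mul_nonneg h3 (hpos y hy1).le]
    simpa using hanti (left_mem_Icc.2 h0) (right_mem_Icc.2 h0) h0
  · have hmono : MonotoneOn
        (fun x : ℝ => Real.log (1 + x) - (x - x ^ 2 / 2 + x ^ 3 / 3 - 0 * x ^ 4)) (Icc x 0) := by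
      refine monotoneOn_of_deriv_nonneg (convex_Icc x 0)
        (fun y hy => (hD y (by linarith [hy.1] : -1 < y)).continuousAt.continuousWithinAt)
        (fun y hy => ?_) (fun y hy => ?_) <;> rw [interior_Icc] at hy
      · exact (hD y (by linarith [hy.1] : -1 < y)).differentiableAt.differentiableWithinAt
      · have hy1 : -1 < y := by linarith [hy.1]
        rw [(hD y hy1).deriv]
        have h3 : y ^ 3 ≤ 0 := by nlinarith [hy.2, sq_nonneg y]
        nlinarith [hpos y hy1, mul_nonneg (neg_nonneg.2 h3) (hpos y hy1).le]
    simpa using hmono (left_mem_Icc.2 h0) (right_mem_Icc.2 h0) h0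

theorem quartic_le_log_one_add {x : ℝ} (hx : -(1 / 2) ≤ x) :
    x - x ^ 2 / 2 + x ^ 3 / 3 - 1 / 2 * x ^ 4 ≤ Real.log (1 + x) := by
  have hD := fun y (hy : y ∈ Ioi (-1 : ℝ)) => hasDerivAt_log_one_add_sub_quartic (1 / 2) hy
  have hle : ∀ y : ℝ, -(1 / 2) ≤ y → 0 ≤ 4 * (1 / 2) - (1 + y)⁻¹ := fun y hy => by
    have : (1 + y)⁻¹ ≤ (1 / 2)⁻¹ := inv_anti₀ (by norm_num) (by linarith)
    norm_num at this ⊢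
    exact this
  suffices h : 0 ≤ Real.log (1 + x) - (x - x ^ 2 / 2 + x ^ 3 / 3 - 1 / 2 * x ^ 4) by linarith
  rcases le_total 0 x with h0 | h0
  · have hmono : MonotoneOn
        (fun x : ℝ => Real.log (1 + x) - (x - x ^ 2 / 2 + x ^ 3 / 3 - 1 / 2 * x ^ 4))
        (Icc 0 x) := by
      refine monotoneOn_of_deriv_nonneg (convex_Icc 0 x)
        (fun y hy => (hD y (by linarith [hy.1] : -1 < y)).continuousAt.continuousWithinAt)
        (fun y hy => ?_) (fun y hy => ?_) <;> rw [interior_Icc] at hy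
      · exact (hD y (by linarith [hy.1] : -1 < y)).differentiableAt.differentiableWithinAt
      · rw [(hD y (by linarith [hy.1] : -1 < y)).deriv]
        exact mul_nonneg (pow_nonneg hy.1.le 3) (hle y (by linarith [hy.1]))
    simpa using hmono (left_mem_Icc.2 h0) (right_mem_Icc.2 h0) h0
  · have hanti : AntitoneOn
        (fun x : ℝ => Real.log (1 + x) - (x - x ^ 2 / 2 + x ^ 3 / 3 - 1 / 2 * x ^ 4))
        (Icc x 0) := by
      refine antitoneOn_of_deriv_nonpos (convex_Icc x 0)
        (fun y hy => (hD y (by linarith [hy.1] : -1 < y)).continuousAt.continuousWithinAt)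
        (fun y hy => ?_) (fun y hy => ?_) <;> rw [interior_Icc] at hy
      · exact (hD y (by linarith [hy.1] : -1 < y)).differentiableAt.differentiableWithinAt
      · rw [(hD y (by linarith [hy.1] : -1 < y)).deriv]
        refine mul_nonpos_of_nonpos_of_nonneg ?_ (hle y (by linarith [hy.1]))
        nlinarith [hy.2, sq_nonneg y]
    simpa using hanti (left_mem_Icc.2 h0) (right_mem_Icc.2 h0) h0

theorem quartic_le_log_one_add_of_le {x y : ℝ} (hxy : x ≤ y) (hy : -(1 / 2) ≤ y) :
    x - x ^ 2 / 2 + x ^ 3 / 3 - 1 / 2 * x ^ 4 ≤ Real.log (1 + y) := by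
  rcases le_total (-(1 / 2)) x with h | h
  · exact (quartic_le_log_one_add h).trans (Real.log_le_log (by linarith) (by linarith))
  · refine le_trans ?_ ((quartic_le_log_one_add (le_refl (-(1 / 2) : ℝ))).trans
      (Real.log_le_log (by norm_num) (by linarith)))
    nlinarith [sq_nonneg x, sq_nonneg (x * x), mul_nonneg (sub_nonneg.2 h) (sq_nonneg x),
      mul_nonneg (sub_nonneg.2 h) (sq_nonneg (x - 1 / 2))]

theorem logQuartic_eq (K c a s : ℝ) : logQuartic K c a s = Real.log c +
    ((s - a) / c - ((s - a) / c) ^ 2 / 2 + ((s - a) / c) ^ 3 / 3 - K * ((s - a) / c) ^ 4) := by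
  unfold logQuartic
  ring

theorem logQuartic_self (K c a : ℝ) : logQuartic K c a a = Real.log c := by
  simp [logQuartic]

theorem log_eq_log_add_log_one_add {c w : ℝ} (hc : 0 < c) (hw : 0 < w) :
    Real.log w = Real.log c + Real.log (1 + (w - c) / c) := by
  have h1 : 1 + (w - c) / c = w / c := by
    field_simp
    ring
  rw [h1, Real.log_div hw.ne' hc.ne']
  ring

theorem log_le_logQuartic {c a s w : ℝ} (hc : 0 < c) (hw : 0 < w) (h : w - s ≤ c - a) :
    Real.log w ≤ logQuartic 0 c a s := by
  have hs : 0 < c + (s - a) := by linarith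
  refine (Real.log_le_log hw (by linarith : w ≤ c + (s - a))).trans ?_
  rw [log_eq_log_add_log_one_add hc hs, logQuartic_eq, add_sub_cancel_left]
  have hx : -1 < (s - a) / c := by
    rw [lt_div_iff₀ hc]
    linarith
  linarith [log_one_add_le_cubic hx]

theorem logQuartic_le_log {c a s w : ℝ} (hc : 0 < c) (hw : c / 2 ≤ w) (h : c - a ≤ w - s) :
    logQuartic (1 / 2) c a s ≤ Real.log w := by
  rw [log_eq_log_add_log_one_add hc (by linarith : 0 < w), logQuartic_eq]
  have hxy : (s - a) / c ≤ (w - c) / c := by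
    exact div_le_div_of_nonneg_right (by linarith) hc.le
  have hy : -(1 / 2) ≤ (w - c) / c := by
    rw [le_div_iff₀ hc]
    linarith
  linarith [quartic_le_log_one_add_of_le hxy hy]

theorem upperSemicontinuousOn_exp_iff {X : Type*} [TopologicalSpace X] {s : Set X} {f : X → ℝ} :
    UpperSemicontinuousOn (fun x => Real.exp (f x)) s ↔ UpperSemicontinuousOn f s := by
  constructor
  · intro h x hx y hy
    filter_upwards [h x hx (Real.exp y) (Real.exp_lt_exp.2 hy)] with z hz
    exact Real.exp_lt_exp.1 hz
  · intro h x hx y hy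
    have hy0 : 0 < y := (Real.exp_pos _).trans hy
    filter_upwards [h x hx (Real.log y) ((Real.lt_log_iff_exp_lt hy0).2 hy)] with z hz
    exact (Real.lt_log_iff_exp_lt hy0).1 hz

theorem lowerSemicontinuousOn_exp_iff {X : Type*} [TopologicalSpace X] {s : Set X} {f : X → ℝ} :
    LowerSemicontinuousOn (fun x => Real.exp (f x)) s ↔ LowerSemicontinuousOn f s := by
  constructor
  · intro h x hx y hy
    filter_upwards [h x hx (Real.exp y) (Real.exp_lt_exp.2 hy)] with z hz
    exact Real.exp_lt_exp.1 hz
  · intro h x hx y hy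
    rcases le_or_gt y 0 with hy0 | hy0
    · exact Eventually.of_forall fun z => hy0.trans_lt (Real.exp_pos _)
    · filter_upwards [h x hx (Real.log y) ((Real.log_lt_iff_lt_exp hy0).2 hy)] with z hz
      exact (Real.log_lt_iff_lt_exp hy0).1 hz

theorem contDiff_exp_add (k : ℝ) : ContDiff ℝ 2 fun s => Real.exp (s + k) := by
  fun_prop

theorem deriv_exp_add (k : ℝ) : (deriv fun s => Real.exp (s + k)) = fun s => Real.exp (s + k) := by
  funext s
  simp

theorem trudSub_exp_iff {n : ℕ} {p : ℝ} (hp : 2 ≤ p) {U : Set (EuclideanSpace ℝ (Fin n) × ℝ)} {v : EuclideanSpace ℝ (Fin n) × ℝ → ℝ} :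
    TrudSub n p U (fun q => Real.exp (v q)) ↔ GpSub n p U v := by
  constructor
  · intro h ψ hψ q hq hmax
    have hF := contDiff_exp_add (v q - ψ q)
    have hd : deriv (fun s => Real.exp (s + (v q - ψ q))) (ψ q) = Real.exp (v q) := by
      simp
    have hdd : deriv (deriv fun s => Real.exp (s + (v q - ψ q))) (ψ q) = Real.exp (v q) := by
      rw [deriv_exp_add, hd]
    have key := h _ (hψ.scalar_comp hF) q hq (by
      filter_upwards [hmax] with z hz
      have : Real.exp (v z) ≤ Real.exp (ψ z + (v q - ψ q)) := Real.exp_le_exp.2 (by linarith)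
      simpa using this)
    rw [trudinger_of_exp_jet hp hψ hF q (Real.exp_pos _) hd hdd] at key
    exact nonneg_of_mul_nonneg_right key (Real.rpow_pos_of_pos (Real.exp_pos _) _)
  · intro h ψ hψ q hq hmax
    have hF := contDiff_logQuartic 0 (Real.exp (v q)) (ψ q)
    have key := h _ (hψ.scalar_comp hF) q hq (by
      filter_upwards [hmax] with z hz
      have := log_le_logQuartic (Real.exp_pos (v q)) (Real.exp_pos (v z)) hz
      rw [Real.log_exp] at this
      simp only [logQuartic_self, Real.log_exp]
      linarith)
    rw [← gp_of_log_jet hp hψ hF q (Real.exp_pos _) (deriv_logQuartic_self _ _ _)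
      (deriv_deriv_logQuartic_self _ _ _)]
    exact mul_nonneg (Real.rpow_pos_of_pos (Real.exp_pos _) _).le key

/-- Lower semicontinuity keeps `exp ∘ v` away from zero near the touching point, where a test
function from below need not be positive. -/
theorem trudSuper_exp_iff {n : ℕ} {p : ℝ} (hp : 2 ≤ p) {U : Set (EuclideanSpace ℝ (Fin n) × ℝ)} {v : EuclideanSpace ℝ (Fin n) × ℝ → ℝ}
    (hv : LowerSemicontinuousOn v U) :
    TrudSuper n p U (fun q => Real.exp (v q)) ↔ GpSuper n p U v := by
  constructor
  · intro h ψ hψ q hq hmin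
    have hF := contDiff_exp_add (v q - ψ q)
    have hd : deriv (fun s => Real.exp (s + (v q - ψ q))) (ψ q) = Real.exp (v q) := by
      simp
    have hdd : deriv (deriv fun s => Real.exp (s + (v q - ψ q))) (ψ q) = Real.exp (v q) := by
      rw [deriv_exp_add, hd]
    have key := h _ (hψ.scalar_comp hF) q hq (by
      filter_upwards [hmin] with z hz
      have : Real.exp (ψ z + (v q - ψ q)) ≤ Real.exp (v z) := Real.exp_le_exp.2 (by linarith)
      simpa using this)
    rw [trudinger_of_exp_jet hp hψ hF q (Real.exp_pos _) hd hdd] at key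
    exact nonpos_of_mul_nonpos_right key (Real.rpow_pos_of_pos (Real.exp_pos _) _)
  · intro h ψ hψ q hq hmin
    have hF := contDiff_logQuartic (1 / 2) (Real.exp (v q)) (ψ q)
    have key := h _ (hψ.scalar_comp hF) q hq (by
      filter_upwards [hmin, lowerSemicontinuousOn_exp_iff.2 hv q hq (Real.exp (v q) / 2)
        (half_lt_self (Real.exp_pos _))] with z hz hz2
      have := logQuartic_le_log (Real.exp_pos (v q)) hz2.le hz
      rw [Real.log_exp] at this
      simp only [logQuartic_self, Real.log_exp]
      linarith)
    rw [← gp_of_log_jet hp hψ hF q (Real.exp_pos _) (deriv_logQuartic_self _ _ _)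
      (deriv_deriv_logQuartic_self _ _ _)]
    exact mul_nonpos_of_nonneg_of_nonpos (Real.rpow_pos_of_pos (Real.exp_pos _) _).le key

/-- Lemma 2.3 (change of variables): for `u = e^v`, `u` is an usc viscosity subsolution of
`Γ_p u = 0` iff `v` is an usc viscosity subsolution of `G_p v = 0`, and likewise for
lsc supersolutions. -/
theorem stmt8 (n : ℕ) (hn : 2 ≤ n) (p : ℝ) (hp : 2 ≤ p)
    (Ω : Set (EuclideanSpace ℝ (Fin n))) (hΩo : IsOpen Ω) (hΩc : IsConnected Ω)
    (T : ℝ) (hT : 0 < T)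
    (u v : EuclideanSpace ℝ (Fin n) × ℝ → ℝ)
    (huv : ∀ q, u q = Real.exp (v q)) :
    ((UpperSemicontinuousOn u (pcyl n Ω (Set.Ioo 0 T) ∪ pbdry n Ω (Set.Ioo 0 T)) ∧
        TrudSub n p (pcyl n Ω (Set.Ioo 0 T)) u) ↔
      (UpperSemicontinuousOn v (pcyl n Ω (Set.Ioo 0 T) ∪ pbdry n Ω (Set.Ioo 0 T)) ∧
        GpSub n p (pcyl n Ω (Set.Ioo 0 T)) v)) ∧
    ((LowerSemicontinuousOn u (pcyl n Ω (Set.Ioo 0 T) ∪ pbdry n Ω (Set.Ioo 0 T)) ∧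
        TrudSuper n p (pcyl n Ω (Set.Ioo 0 T)) u) ↔
      (LowerSemicontinuousOn v (pcyl n Ω (Set.Ioo 0 T) ∪ pbdry n Ω (Set.Ioo 0 T)) ∧
        GpSuper n p (pcyl n Ω (Set.Ioo 0 T)) v)) := by
  obtain rfl : u = fun q => Real.exp (v q) := funext huv
  rw [upperSemicontinuousOn_exp_iff, lowerSemicontinuousOn_exp_iff, trudSub_exp_iff hp]
  exact ⟨Iff.rfl, and_congr_right fun h => trudSuper_exp_iff hp (h.mono subset_union_left)⟩
end

section
/- Let 2 ≤ p < ∞, let Ω ⊂ ℝⁿ (n ≥ 2) be a domain, λ, μ ∈ ℝ and T > 0. Suppose ψ : Ω → (0,∞) is upper semicontinuous and is a viscosity subsolution of Δ_p ψ + λ ψ^{p−1} = 0 in Ω (i.e. Δ_pψ + λψ^{p−1} ≥ 0 in the viscosity sense). If μ ≥ λ and u(x,t) = ψ(x) e^{−μt/(p−1)}, then u is a viscosity subsolution of Γ_p u = 0 in Ω×(0,T). Analogously, if ψ is lower semicontinuous and a viscosity supersolution of Δ_pψ + λψ^{p−1} = 0 and μ ≤ λ, then u(x,t) = ψ(x)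 e^{−μt/(p−1)} is a viscosity supersolution of Γ_p u = 0. -/
open Set Filter
open scoped Classical

theorem gradient_const_mul {F : Type*} [NormedAddCommGroup F] [InnerProductSpace ℝ F]
    [CompleteSpace F] {f : F → ℝ} {x : F} (hf : DifferentiableAt ℝ f x) (c : ℝ) :
    gradient (fun y => c * f y) x = c • gradient f x := by
  simp [gradient, fderiv_const_mul hf]

theorem iteratedFDeriv_two_const_mul {F : Type*} [NormedAddCommGroup F] [NormedSpace ℝ F]
    {f : F → ℝ} (hf : ContDiff ℝ 2 f) (c : ℝ) (x : F) (m : Fin 2 → F) :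
    iteratedFDeriv ℝ 2 (fun y => c * f y) x m = c * iteratedFDeriv ℝ 2 f x m := by
  have h := iteratedFDeriv_const_smul_apply (𝕜 := ℝ) (i := 2) (a := c) (x := x) (f := f)
    (by exact_mod_cast hf.contDiffAt)
  exact congrArg (fun L => L m) h

/-- The p-Laplacian is positively homogeneous of degree `p - 1`. -/
theorem pLap_const_mul {n : ℕ} {p c : ℝ} (hc : 0 < c) {φ : EuclideanSpace ℝ (Fin n) → ℝ}
    (hφ : ContDiff ℝ 2 φ) (x : EuclideanSpace ℝ (Fin n)) :
    pLap n p (fun y => c * φ y) x = c ^ (p - 1) * pLap n p φ x := by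
  have hg := gradient_const_mul (hφ.differentiable (by norm_num) x) c
  have h1 : c ^ (p - 1) = c ^ (p - 2) * c := by
    rw [← Real.rpow_add_one hc.ne']; ring_nf
  have h2 : c ^ (p - 1) = c ^ (p - 4) * c * c ^ 2 := by
    rw [← Real.rpow_add_one hc.ne', ← Real.rpow_natCast, ← Real.rpow_add hc]
    push_cast
    ring_nf
  unfold pLap
  rw [hg]
  simp only [iteratedFDeriv_two_const_mul hφ, smul_eq_zero, hc.ne', false_or, ← Finset.mul_sum]
  split_ifs with h0 hp2
  · subst hp2
    norm_num
  · simp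
  · have h3 : iteratedFDeriv ℝ 2 φ x ![c • gradient φ x, c • gradient φ x] =
        c ^ 2 * iteratedFDeriv ℝ 2 φ x ![gradient φ x, gradient φ x] := by
      have h := (iteratedFDeriv ℝ 2 φ x).map_smul_univ (fun _ => c)
        ![gradient φ x, gradient φ x]
      have h' : (fun i => c • (![gradient φ x, gradient φ x] : Fin 2 → _) i) =
          ![c • gradient φ x, c • gradient φ x] := by
        ext i : 1
        fin_cases i <;> rfl
      rw [h'] at h
      rw [h]
      simp [pow_two]
    rw [h3, norm_smul, Real.norm_of_nonneg hc.le, Real.mul_rpow hc.le (norm_nonneg _),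
      Real.mul_rpow hc.le (norm_nonneg _), mul_add]
    nth_rewrite 1 [h1]
    rw [h2]
    ring

theorem timeDeriv_eq_of_isLocalExtr {n : ℕ} {u φ : EuclideanSpace ℝ (Fin n) × ℝ → ℝ}
    {q : EuclideanSpace ℝ (Fin n) × ℝ} {v : ℝ} (hφ : ParaTestFn n φ)
    (hu : HasDerivAt (fun t => u (q.1, t)) v q.2) (h : IsLocalExtr (fun z => u z - φ z) q) :
    timeDeriv n φ q = v := by
  have hd := ((hφ.2 q.1).differentiable (by norm_num) q.2).hasDerivAt
  have hc : ContinuousAt (fun t : ℝ => (q.1, t)) q.2 := by fun_prop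
  have h0 : IsLocalExtr (fun t => u (q.1, t) - φ (q.1, t)) q.2 :=
    IsExtrFilter.comp_tendsto (f := fun z => u z - φ z) (g := fun t : ℝ => (q.1, t)) h hc
  have := h0.hasDerivAt_eq_zero (hu.sub hd)
  unfold timeDeriv
  linarith

/-- The residual of Trudinger's operator at a contact point with a separated function, written
through the elliptic operator applied to the rescaled spatial test function. -/
theorem trudinger_residual_separated {n : ℕ} {p μ : ℝ} (hp : 2 ≤ p)
    {ψ : EuclideanSpace ℝ (Fin n) → ℝ} {φ : EuclideanSpace ℝ (Fin n) × ℝ → ℝ}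
    {q : EuclideanSpace ℝ (Fin n) × ℝ} (hφ : ParaTestFn n φ) (hψ : 0 < ψ q.1)
    (h : IsLocalExtr (fun z => ψ z.1 * Real.exp (-μ * z.2 / (p - 1)) - φ z) q) :
    pSpaceLap n p φ q - (p - 1) * (ψ q.1 * Real.exp (-μ * q.2 / (p - 1))) ^ (p - 2) *
        timeDeriv n φ q =
      Real.exp (-μ * q.2 / (p - 1)) ^ (p - 1) *
        (pLap n p (fun x => (Real.exp (-μ * q.2 / (p - 1)))⁻¹ * φ (x, q.2)) q.1 +
          μ * ψ q.1 ^ (p - 1)) := by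
  have hp1 : p - 1 ≠ 0 := by linarith
  have hE := Real.exp_pos (-μ * q.2 / (p - 1))
  have hu : HasDerivAt (fun t => ψ q.1 * Real.exp (-μ * t / (p - 1)))
      (ψ q.1 * (Real.exp (-μ * q.2 / (p - 1)) * (-μ / (p - 1)))) q.2 := by
    have h1 := (((hasDerivAt_id q.2).const_mul (-μ)).div_const (p - 1)).exp.const_mul (ψ q.1)
    simpa using h1
  rw [timeDeriv_eq_of_isLocalExtr (u := fun z => ψ z.1 * Real.exp (-μ * z.2 / (p - 1))) hφ hu h,
    pLap_const_mul (inv_pos.2 hE) (hφ.1 q.2), pSpaceLap]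
  set E := Real.exp (-μ * q.2 / (p - 1))
  have h1 : E ^ (p - 1) * E⁻¹ ^ (p - 1) = 1 := by
    rw [← Real.mul_rpow hE.le (inv_nonneg.2 hE.le), mul_inv_cancel₀ hE.ne', Real.one_rpow]
  have h2 : (ψ q.1 * E) ^ (p - 2) * (ψ q.1 * E) = E ^ (p - 1) * ψ q.1 ^ (p - 1) := by
    rw [← Real.rpow_add_one (mul_pos hψ hE).ne', ← Real.mul_rpow hE.le hψ.le]
    ring_nf
  have h3 : (p - 1) * (-μ / (p - 1)) = -μ := by field_simp
  linear_combination (-pLap n p (fun x => φ (x, q.2)) q.1) * h1 + μ * h2 -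
    (ψ q.1 * E) ^ (p - 2) * (ψ q.1 * E) * h3

/-- Lemma 2.5(a) (separation of variables): if `Δ_p ψ + λψ^{p−1} ≥ 0` and `μ ≥ λ` then
`u(x,t) = ψ(x)e^{−μt/(p−1)}` satisfies `Γ_p u ≥ 0`; dually for supersolutions with `μ ≤ λ`. -/
theorem stmt9 (n : ℕ) (hn : 2 ≤ n) (p : ℝ) (hp : 2 ≤ p)
    (Ω : Set (EuclideanSpace ℝ (Fin n))) (hΩo : IsOpen Ω) (hΩc : IsConnected Ω)
    (lam μ T : ℝ) (hT : 0 < T) :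
    (∀ ψ : EuclideanSpace ℝ (Fin n) → ℝ,
      UpperSemicontinuousOn ψ Ω → (∀ x ∈ Ω, 0 < ψ x) →
      PLapFSub n p (fun _ s => lam * s ^ (p - 1)) Ω ψ → lam ≤ μ →
      TrudSub n p (pcyl n Ω (Set.Ioo 0 T))
        (fun q => ψ q.1 * Real.exp (-μ * q.2 / (p - 1)))) ∧
    (∀ ψ : EuclideanSpace ℝ (Fin n) → ℝ,
      LowerSemicontinuousOn ψ Ω → (∀ x ∈ Ω, 0 < ψ x) →
      PLapFSuper n p (fun _ s => lam * s ^ (p - 1)) Ω ψ → μ ≤ lam →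
      TrudSuper n p (pcyl n Ω (Set.Ioo 0 T))
        (fun q => ψ q.1 * Real.exp (-μ * q.2 / (p - 1)))) := by
  have hopen : IsOpen (pcyl n Ω (Set.Ioo 0 T)) := hΩo.prod isOpen_Ioo
  constructor
  · intro ψ _ hpos hsub hle φ hφ q hq hmax
    have hloc := hmax.isLocalMax (hopen.mem_nhds hq)
    have hE := Real.exp_pos (-μ * q.2 / (p - 1))
    have hcont : ContinuousAt (fun x : EuclideanSpace ℝ (Fin n) => (x, q.2)) q.1 := by fun_prop
    have hx : IsLocalMax
        (fun x => ψ x - (Real.exp (-μ * q.2 / (p - 1)))⁻¹ * φ (x, q.2)) q.1 := by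
      filter_upwards [hcont.eventually hloc] with x hx
      generalize Real.exp (-μ * q.2 / (p - 1)) = E at hE hx ⊢
      rw [← mul_le_mul_iff_right₀ hE]
      field_simp
      linarith
    have key := hsub _ (contDiff_const.mul (hφ.1 q.2)) q.1 hq.1 (hx.on Ω)
    beta_reduce
    rw [trudinger_residual_separated hp hφ (hpos _ hq.1) hloc.isExtr]
    have hψ := Real.rpow_pos_of_pos (hpos _ hq.1) (p - 1)
    have := mul_le_mul_of_nonneg_right hle hψ.le
    exact mul_nonneg (Real.rpow_nonneg hE.le _) (by linarith)
  · intro ψ _ hpos hsuper hle φ hφ q hq hmin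
    have hloc := hmin.isLocalMin (hopen.mem_nhds hq)
    have hE := Real.exp_pos (-μ * q.2 / (p - 1))
    have hcont : ContinuousAt (fun x : EuclideanSpace ℝ (Fin n) => (x, q.2)) q.1 := by fun_prop
    have hx : IsLocalMin
        (fun x => ψ x - (Real.exp (-μ * q.2 / (p - 1)))⁻¹ * φ (x, q.2)) q.1 := by
      filter_upwards [hcont.eventually hloc] with x hx
      generalize Real.exp (-μ * q.2 / (p - 1)) = E at hE hx ⊢
      rw [← mul_le_mul_iff_right₀ hE]
      field_simp
      linarith
    have key := hsuper _ (contDiff_const.mul (hφ.1 q.2)) q.1 hq.1 (hx.on Ω)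
    beta_reduce
    rw [trudinger_residual_separated hp hφ (hpos _ hq.1) hloc.isExtr]
    have hψ := Real.rpow_pos_of_pos (hpos _ hq.1) (p - 1)
    have := mul_le_mul_of_nonneg_right hle hψ.le
    exact mul_nonpos_of_nonneg_of_nonpos (Real.rpow_nonneg hE.le _) (by linarith)
end

section
/- Let n ≥ 2, 2 ≤ p < ∞ and R > 0. Set k = p + n − 2, α = (2p + k − 1)/(2(p−1)), θ = √(k/(k+1)) and λ_p = (k θ^{p−2}/R^p) (2α/(1−θ²))^{p−1}. Define η(r) = (1 − (r/R)²)^α for 0 ≤ r ≤ R. Then for every r ∈ (0,R): |η'(r)|^{p−2} ( (p−1) η''(r) + ((n−1)/r) η'(r) ) + λ_p η(r)^{p−1} ≥ 0. -/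
open Set Filter

/-- The first derivative of the profile `r ↦ (1 − (r/R)²)^α` where the base is nonzero. -/
lemma hasDerivAt_one_sub_sq_rpow (R α r : ℝ) (ht : 1 - (r / R) ^ 2 ≠ 0) :
    HasDerivAt (fun x : ℝ => (1 - (x / R) ^ 2) ^ α)
      (-(2 * α / R) * (r / R) * (1 - (r / R) ^ 2) ^ (α - 1)) r := by
  have h1 : HasDerivAt (fun x : ℝ => 1 - (x / R) ^ 2) (-(2 * (r / R) * (1 / R))) r := by
    simpa using (((hasDerivAt_id r).div_const R).pow 2).const_sub 1
  convert h1.rpow_const (p := α) (Or.inl ht) using 1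
  ring

/-- The second derivative of the profile `r ↦ (1 − (r/R)²)^α` on `(0, R)`. -/
lemma deriv_deriv_one_sub_sq_rpow {R r : ℝ} (α : ℝ) (ht : 0 < 1 - (r / R) ^ 2) :
    deriv (deriv fun x : ℝ => (1 - (x / R) ^ 2) ^ α) r =
      2 * α / R ^ 2 * (1 - (r / R) ^ 2) ^ (α - 2) *
        (2 * (α - 1) * (r / R) ^ 2 - (1 - (r / R) ^ 2)) := by
  have hev : deriv (fun x : ℝ => (1 - (x / R) ^ 2) ^ α) =ᶠ[nhds r]
      fun x => -(2 * α / R) * (x / R) * (1 - (x / R) ^ 2) ^ (α - 1) := by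
    have hc : ContinuousAt (fun x : ℝ => 1 - (x / R) ^ 2) r := by fun_prop
    filter_upwards [hc.eventually_ne ht.ne'] with x hx
    exact (hasDerivAt_one_sub_sq_rpow R α x hx).deriv
  rw [hev.deriv_eq]
  have h1 : HasDerivAt (fun x : ℝ => -(2 * α / R) * (x / R)) (-(2 * α / R) * (1 / R)) r :=
    ((hasDerivAt_id r).div_const R).const_mul _
  have h2 := (h1.mul (hasDerivAt_one_sub_sq_rpow R (α - 1) r ht.ne')).deriv
  have h3 : (1 - (r / R) ^ 2) ^ (α - 1) = (1 - (r / R) ^ 2) ^ (α - 2) * (1 - (r / R) ^ 2) := by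
    rw [← Real.rpow_add_one ht.ne']; congr 1; ring
  refine h2.trans ?_
  rw [h3, show α - 1 - 1 = α - 2 by ring]
  ring

theorem stmt10 (n : ℕ) (hn : 2 ≤ n) (p : ℝ) (hp : 2 ≤ p) (R : ℝ) (hR : 0 < R)
    (k α θ lam : ℝ)
    (hk : k = p + n - 2)
    (hα : α = (2 * p + k - 1) / (2 * (p - 1)))
    (hθ : θ = Real.sqrt (k / (k + 1)))
    (hlam : lam = k * θ ^ (p - 2) / R ^ p * (2 * α / (1 - θ ^ 2)) ^ (p - 1))
    (η : ℝ → ℝ) (hη : ∀ r : ℝ, η r = (1 - (r / R) ^ 2) ^ α) :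
    ∀ r ∈ Set.Ioo (0 : ℝ) R,
      0 ≤ |deriv η r| ^ (p - 2) *
            ((p - 1) * deriv (deriv η) r + ((n : ℝ) - 1) / r * deriv η r) +
          lam * η r ^ (p - 1) := by
  rintro r ⟨hr0, hrR⟩
  obtain rfl : η = fun x : ℝ => (1 - (x / R) ^ 2) ^ α := funext hη
  have hn' : (2 : ℝ) ≤ n := by exact_mod_cast hn
  have hk0 : 0 < k := by linarith
  have hα0 : 0 < α := by rw [hα]; apply div_pos <;> linarith
  have hα1 : 2 * (p - 1) * (α - 1) = k + 1 := by
    have : p - 1 ≠ 0 := by linarith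
    rw [hα]; field_simp; ring
  have hθ0 : 0 ≤ θ := by rw [hθ]; positivity
  have hθ2 : θ ^ 2 = k / (k + 1) := by rw [hθ, Real.sq_sqrt (by positivity)]
  have hθ1 : 1 - θ ^ 2 = 1 / (k + 1) := by rw [hθ2]; field_simp; ring
  have hs0 : 0 < r / R := by positivity
  have hs1 : r / R < 1 := (div_lt_one hR).2 hrR
  have ht : 0 < 1 - (r / R) ^ 2 := by nlinarith
  have hrs : r = R * (r / R) := by field_simp
  have hd1 := (hasDerivAt_one_sub_sq_rpow R α r ht.ne').deriv
  have hd2 := deriv_deriv_one_sub_sq_rpow α ht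
  rw [hd2, hd1]
  beta_reduce
  have hnr : ((n : ℝ) - 1) / r = (n - 1) / (R * (r / R)) := by rw [← hrs]
  rw [hnr]
  clear hnr hrs hd1 hd2 hη
  set s := r / R
  set t := 1 - s ^ 2 with ht_def
  have hta : t ^ (α - 1) = t ^ (α - 2) * t := by
    rw [← Real.rpow_add_one ht.ne']; congr 1; ring
  have htb : t ^ α = t ^ (α - 1) * t := by
    rw [← Real.rpow_add_one ht.ne']; congr 1; ring
  have hop : (p - 1) * (2 * α / R ^ 2 * t ^ (α - 2) * (2 * (α - 1) * s ^ 2 - t)) +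
      ((n : ℝ) - 1) / (R * s) * (-(2 * α / R) * s * t ^ (α - 1)) =
      2 * α / R ^ 2 * t ^ (α - 2) * ((k + 1) * s ^ 2 - k * t) := by
    rw [hta, ← hα1, hk]
    field_simp
    ring
  rw [hop]
  set A := 2 * α / R * t ^ (α - 1) with hA
  have hA0 : 0 < A := by positivity
  have habs : |-(2 * α / R) * s * t ^ (α - 1)| = A * s := by
    rw [show -(2 * α / R) * s * t ^ (α - 1) = -(A * s) by rw [hA]; ring, abs_neg,
      abs_of_pos (by positivity)]
  rw [habs]
  have h1θ : 0 < 1 - θ ^ 2 := by rw [hθ1]; positivity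
  have hlam0 : 0 ≤ lam := by rw [hlam]; positivity
  by_cases hcase : 0 ≤ (k + 1) * s ^ 2 - k * t
  · positivity
  push Not at hcase
  have hsθ2 : s ^ 2 ≤ θ ^ 2 := by
    rw [hθ2, le_div_iff₀ (by positivity)]
    nlinarith [mul_pos hk0 (pow_pos hs0 2)]
  have hsθ : s ≤ θ := by nlinarith
  have hAle : A ≤ 2 * α / (1 - θ ^ 2) / R * t ^ α := by
    rw [hA, htb]
    have : 1 ≤ t / (1 - θ ^ 2) := by rw [one_le_div h1θ]; linarith
    calc 2 * α / R * t ^ (α - 1) = 2 * α / R * t ^ (α - 1) * 1 := (mul_one _).symm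
      _ ≤ 2 * α / R * t ^ (α - 1) * (t / (1 - θ ^ 2)) := by gcongr
      _ = _ := by ring
  have hAp : A ^ (p - 1) = A ^ (p - 2) * A := by
    rw [← Real.rpow_add_one hA0.ne']; congr 1; ring
  have hRp : R ^ p = R ^ (p - 1) * R := by
    rw [← Real.rpow_add_one hR.ne']; congr 1; ring
  have hbound : k * s ^ (p - 2) / R * A ^ (p - 1) ≤ lam * (t ^ α) ^ (p - 1) := by
    calc k * s ^ (p - 2) / R * A ^ (p - 1)
        ≤ k * θ ^ (p - 2) / R * (2 * α / (1 - θ ^ 2) / R * t ^ α) ^ (p - 1) := by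
          have : 0 ≤ p - 1 := by linarith
          have : 0 ≤ p - 2 := by linarith
          gcongr
      _ = lam * (t ^ α) ^ (p - 1) := by
          rw [hlam, hRp, Real.mul_rpow (by positivity) (by positivity),
            Real.div_rpow (by positivity) hR.le]
          field_simp
  have hmain : (A * s) ^ (p - 2) * (2 * α / R ^ 2 * t ^ (α - 2) * ((k + 1) * s ^ 2 - k * t)) =
      (A * s) ^ (p - 2) * (2 * α / R ^ 2 * t ^ (α - 2) * ((k + 1) * s ^ 2)) -
        k * s ^ (p - 2) / R * A ^ (p - 1) := by
    rw [hAp, Real.mul_rpow hA0.le hs0.le]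
    have : A / R = 2 * α / R ^ 2 * (t ^ (α - 2) * t) := by
      rw [hA, hta]; field_simp
    linear_combination (k * A ^ (p - 2) * s ^ (p - 2)) * this
  have hpos : 0 ≤ (A * s) ^ (p - 2) * (2 * α / R ^ 2 * t ^ (α - 2) * ((k + 1) * s ^ 2)) := by
    positivity
  linarith
end

section
/- Let R > 0, set λ_∞ = 2⁸/R⁴ and define η(r) = (1 − (r/R)²)² for 0 ≤ r ≤ R. Then for every r ∈ (0,R): (η'(r))² η''(r) + λ_∞ η(r)³ ≥ 0. -/
open Set Filter

/-- Lemma 2.6(ii): the radial profile `η(r) = (1 − (r/R)²)²` satisfies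
`Δ_∞ η + λ_∞ η³ ≥ 0` on `(0,R)` in radial form, where `λ_∞ = 2⁸/R⁴`. -/
theorem stmt11 (R : ℝ) (hR : 0 < R) (lam : ℝ) (hlam : lam = 2 ^ 8 / R ^ 4)
    (η : ℝ → ℝ) (hη : ∀ r : ℝ, η r = (1 - (r / R) ^ 2) ^ 2) :
    ∀ r ∈ Set.Ioo (0 : ℝ) R,
      0 ≤ deriv η r ^ 2 * deriv (deriv η) r + lam * η r ^ 3 := by
  intro r _
  have hbase (x : ℝ) : HasDerivAt (fun y : ℝ => 1 - (y / R) ^ 2) (-(2 * (x / R) * (1 / R))) x := by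
    simpa using (((hasDerivAt_id x).div_const R).pow 2).const_sub 1
  have hη' : deriv η = fun x => -(4 / R) * ((x / R) * (1 - (x / R) ^ 2)) := by
    funext x
    rw [funext hη, ((hbase x).fun_pow 2).deriv]
    push_cast
    ring
  have hη'' : deriv (deriv η) r = 4 / R ^ 2 * (3 * (r / R) ^ 2 - 1) := by
    rw [hη', ((((hasDerivAt_id' r).div_const R).fun_mul (hbase r)).const_mul (-(4 / R))).deriv]
    ring
  rw [hη'', hη', hη, hlam]
  set t := r / R
  have hfactor : (-(4 / R) * (t * (1 - t ^ 2))) ^ 2 * (4 / R ^ 2 * (3 * t ^ 2 - 1))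
      + 2 ^ 8 / R ^ 4 * ((1 - t ^ 2) ^ 2) ^ 3
      = 64 / R ^ 4 * (1 - t ^ 2) ^ 2 * (t ^ 2 * (3 * t ^ 2 - 1) + 4 * (1 - t ^ 2) ^ 4) := by
    ring
  have hpoly : 0 ≤ t ^ 2 * (3 * t ^ 2 - 1) + 4 * (1 - t ^ 2) ^ 4 := by
    linarith [sq_nonneg (2 * (1 - t ^ 2) ^ 2 - 1), sq_nonneg ((1 - t ^ 2) - 5 / 14)]
  rw [hfactor]
  positivity
end

section
/- Let n ≥ 2, 2 ≤ p < ∞, T > 0 and α > 0. Suppose a > 0 and b > 0 satisfy a = n p^{p−1} b^{p−1} / ( (p−1)^p (1 + α(p−1)) ) and 0 < b^{p−1} (p/(p−1))^p (T+1)^{α(p−1)+1} < α. Define v(r,t) = a[ (t+1)^{α(p−1)+1} − 1 ] + b (t+1)^α r^{p/(p−1)} for r ≥ 0, 0 ≤ t ≤ T. Then for every r > 0 and 0 < t < T: |∂_r v|^{p−2} ( (p−1) ∂_{rr} v + ((n−1)/r) ∂_r v ) + (p−1) |∂_r v|^p − (p−1) ∂_t v ≤ 0. -/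
open Set Filter

/-- Lemma 2.7(i): the function
`v(r,t) = a[(t+1)^{α(p−1)+1} − 1] + b(t+1)^α r^{p/(p−1)}` satisfies `G_p v ≤ 0` in radial
form for `r > 0`, `0 < t < T`. -/
theorem stmt12 (n : ℕ) (hn : 2 ≤ n) (p : ℝ) (hp : 2 ≤ p) (T α a b : ℝ)
    (hT : 0 < T) (hα : 0 < α) (ha0 : 0 < a) (hb0 : 0 < b)
    (ha : a = (n : ℝ) * p ^ (p - 1) * b ^ (p - 1) / ((p - 1) ^ p * (1 + α * (p - 1))))
    (hb : b ^ (p - 1) * (p / (p - 1)) ^ p * (T + 1) ^ (α * (p - 1) + 1) < α)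
    (v : ℝ → ℝ → ℝ)
    (hv : ∀ r t : ℝ, v r t =
      a * ((t + 1) ^ (α * (p - 1) + 1) - 1) + b * (t + 1) ^ α * r ^ (p / (p - 1))) :
    ∀ r t : ℝ, 0 < r → 0 < t → t < T →
      |deriv (fun s => v s t) r| ^ (p - 2) *
          ((p - 1) * deriv (deriv fun s => v s t) r +
            ((n : ℝ) - 1) / r * deriv (fun s => v s t) r) +
        (p - 1) * |deriv (fun s => v s t) r| ^ p -
        (p - 1) * deriv (fun s => v r s) t ≤ 0 := by
  intro r t hr ht htT
  have hp1 : 0 < p - 1 := by linarith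
  have hτ : 0 < t + 1 := by linarith
  have hτT : t + 1 ≤ T + 1 := by linarith
  set q : ℝ := p / (p - 1) with hq_def
  have hq : 0 < q := by positivity
  have hq1 : (q - 1) * (p - 1) = 1 := by rw [hq_def]; field_simp; ring
  have hpow : ∀ x : ℝ, 0 < x → x ^ p = x ^ (p - 1) * x := fun x hx => by
    rw [← Real.rpow_add_one hx.ne', sub_add_cancel]
  have hpow2 : ∀ x : ℝ, 0 < x → x ^ (p - 2) = x ^ (p - 1) / x := fun x hx => by
    rw [← Real.rpow_sub_one hx.ne']; ring_nf
  have hA : 0 < (t + 1) ^ α := Real.rpow_pos_of_pos hτ _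
  have hR : 0 < r ^ q := Real.rpow_pos_of_pos hr _
  have hderiv_r : deriv (fun s => v s t) = fun s => b * (t + 1) ^ α * (q * s ^ (q - 1)) := by
    funext s
    have hq_one : 1 ≤ q := by
      rw [hq_def, one_le_div hp1]; linarith
    simp only [hv]
    exact (((Real.hasDerivAt_rpow_const (Or.inr hq_one)).const_mul _).const_add _).deriv
  have hderiv_rr : deriv (deriv fun s => v s t) r =
      b * (t + 1) ^ α * (q * ((q - 1) * r ^ (q - 1 - 1))) := by
    rw [hderiv_r]
    exact (((Real.hasDerivAt_rpow_const (Or.inl hr.ne')).const_mul _).const_mul _).deriv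
  have hτ_deriv : ∀ e : ℝ, HasDerivAt (fun s : ℝ => (s + 1) ^ e) (e * (t + 1) ^ (e - 1)) t :=
    fun e => by
      simpa using ((hasDerivAt_id t).add_const (1 : ℝ)).rpow_const (p := e) (Or.inl hτ.ne')
  have hderiv_t : deriv (fun s => v r s) t =
      a * ((α * (p - 1) + 1) * (t + 1) ^ (α * (p - 1) + 1 - 1)) +
        b * (α * (t + 1) ^ (α - 1)) * r ^ q := by
    simp only [hv]
    exact ((((hτ_deriv _).sub_const 1).const_mul a).add
      (((hτ_deriv α).const_mul b).mul_const _)).deriv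
  rw [hderiv_rr, hderiv_t, hderiv_r]
  rw [add_sub_cancel_right, Real.rpow_sub_one hτ.ne', Real.rpow_sub_one hr.ne' (q - 1)]
  set D : ℝ := b * (t + 1) ^ α * (q * r ^ (q - 1)) with hD_def
  have hD : 0 < D := by positivity
  have hDr : D * r = b * (t + 1) ^ α * q * r ^ q := by
    rw [hD_def, Real.rpow_sub_one hr.ne']; field_simp
  have hDp : D ^ (p - 1) = b ^ (p - 1) * (t + 1) ^ (α * (p - 1)) * q ^ (p - 1) * r := by
    rw [hD_def, Real.mul_rpow (by positivity) (by positivity), Real.mul_rpow hb0.le hA.le,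
      Real.mul_rpow hq.le (by positivity), ← Real.rpow_mul hτ.le, ← Real.rpow_mul hr.le, hq1,
      Real.rpow_one]
    ring
  have hbound : b ^ (p - 1) * (q ^ (p - 1) * q) * ((t + 1) ^ (α * (p - 1)) * (t + 1)) ≤ α := by
    rw [← hpow q hq, ← Real.rpow_add_one hτ.ne']
    refine le_trans ?_ hb.le
    gcongr
  have hsource : (p - 1) * (a * (α * (p - 1) + 1)) = n * b ^ (p - 1) * q ^ (p - 1) := by
    have hden : 0 < 1 + α * (p - 1) := by positivity
    have hpp : 0 < (p - 1) ^ (p - 1) := Real.rpow_pos_of_pos hp1 _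
    rw [ha, hpow (p - 1) hp1, hq_def, Real.div_rpow (by linarith) hp1.le]
    field_simp
    ring
  have hdiffusion : |D| ^ (p - 2) *
      ((p - 1) * (b * (t + 1) ^ α * (q * ((q - 1) * (r ^ (q - 1) / r)))) + (n - 1) / r * D) =
      n * b ^ (p - 1) * q ^ (p - 1) * (t + 1) ^ (α * (p - 1)) := by
    have hsum : (p - 1) * (b * (t + 1) ^ α * (q * ((q - 1) * (r ^ (q - 1) / r)))) +
        (n - 1) / r * D = n * D / r := by
      linear_combination D / r * hq1
    rw [hsum, abs_of_pos hD, hpow2 D hD, hDp]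
    field_simp
  have hgradient : |D| ^ p ≤ b * (α * ((t + 1) ^ α / (t + 1))) * r ^ q := by
    rw [abs_of_pos hD, hpow D hD, hDp]
    calc b ^ (p - 1) * (t + 1) ^ (α * (p - 1)) * q ^ (p - 1) * r * D
        = b ^ (p - 1) * (q ^ (p - 1) * q) * ((t + 1) ^ (α * (p - 1)) * (t + 1)) *
            (b * ((t + 1) ^ α / (t + 1)) * r ^ q) := by
          rw [mul_assoc _ r, mul_comm r, hDr]; field_simp
      _ ≤ α * (b * ((t + 1) ^ α / (t + 1)) * r ^ q) := by gcongr
      _ = b * (α * ((t + 1) ^ α / (t + 1))) * r ^ q := by ring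
  rw [hdiffusion]
  linear_combination (p - 1) * hgradient - (t + 1) ^ (α * (p - 1)) * hsource
end

section
/- Let T > 0 and α > 0. Suppose a > 0 and b > 0 satisfy a = 4³ b³ / (3⁵ (3α+1)) and 0 < b³ (4⁴/3⁵) (T+1)^{3α+1} < α. Define v(r,t) = a[ (t+1)^{3α+1} − 1 ] + b (t+1)^α r^{4/3} for r ≥ 0, 0 ≤ t ≤ T. Then for every r > 0 and 0 < t < T: (∂_r v)² ∂_{rr} v + (∂_r v)⁴ − 3 ∂_t v ≤ 0. -/
open Set Filter

/-- Lemma 2.7(ii): the function `v(r,t) = a[(t+1)^{3α+1} − 1] + b(t+1)^α r^{4/3}` satisfies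
`G_∞ v ≤ 0` in radial form for `r > 0`, `0 < t < T`. -/
theorem stmt13 (T α a b : ℝ) (hT : 0 < T) (hα : 0 < α) (ha0 : 0 < a) (hb0 : 0 < b)
    (ha : a = 4 ^ 3 * b ^ 3 / (3 ^ 5 * (3 * α + 1)))
    (hb : b ^ 3 * (4 ^ 4 / 3 ^ 5) * (T + 1) ^ (3 * α + 1) < α)
    (v : ℝ → ℝ → ℝ)
    (hv : ∀ r t : ℝ, v r t =
      a * ((t + 1) ^ (3 * α + 1) - 1) + b * (t + 1) ^ α * r ^ ((4 : ℝ) / 3)) :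
    ∀ r t : ℝ, 0 < r → 0 < t → t < T →
      deriv (fun s => v s t) r ^ 2 * deriv (deriv fun s => v s t) r +
        deriv (fun s => v s t) r ^ 4 - 3 * deriv (fun s => v r s) t ≤ 0 := by
  intro r t hr ht htT
  have ht1 : 0 < t + 1 := by linarith
  have hdr : ∀ s : ℝ, 0 < s →
      HasDerivAt (fun s => v s t) (b * (t + 1) ^ α * (4 / 3 * s ^ ((1 : ℝ) / 3))) s := by
    intro s hs
    have h := ((Real.hasDerivAt_rpow_const (x := s) (p := (4 : ℝ) / 3)
      (Or.inl hs.ne')).const_mul (b * (t + 1) ^ α)).const_add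
        (a * ((t + 1) ^ (3 * α + 1) - 1))
    rw [show (4 : ℝ) / 3 - 1 = 1 / 3 by norm_num] at h
    simpa only [hv] using h
  have hdrr : deriv (deriv fun s => v s t) r =
      b * (t + 1) ^ α * (4 / 3 * (1 / 3 * r ^ (-(2 : ℝ) / 3))) := by
    have heq : (deriv fun s => v s t) =ᶠ[nhds r]
        fun s => b * (t + 1) ^ α * (4 / 3 * s ^ ((1 : ℝ) / 3)) := by
      filter_upwards [lt_mem_nhds hr] with s hs using (hdr s hs).deriv
    rw [heq.deriv_eq]
    have h := (((Real.hasDerivAt_rpow_const (x := r) (p := (1 : ℝ) / 3)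
      (Or.inl hr.ne')).const_mul (4 / 3)).const_mul (b * (t + 1) ^ α))
    rw [show (1 : ℝ) / 3 - 1 = -2 / 3 by norm_num] at h
    exact h.deriv
  have hdt : deriv (fun s => v r s) t =
      a * ((3 * α + 1) * (t + 1) ^ (3 * α)) +
        b * (α * (t + 1) ^ (α - 1)) * r ^ ((4 : ℝ) / 3) := by
    have hpow : ∀ p : ℝ, HasDerivAt (fun s : ℝ => (s + 1) ^ p) (p * (t + 1) ^ (p - 1)) t := by
      intro p
      simpa using ((hasDerivAt_id t).add_const 1).rpow_const (p := p) (Or.inl ht1.ne')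
    have h := (((hpow (3 * α + 1)).sub_const 1).const_mul a).add
      (((hpow α).const_mul b).mul_const (r ^ ((4 : ℝ) / 3)))
    rw [add_sub_cancel_right] at h
    simp only [hv]
    exact h.deriv
  rw [(hdr r hr).deriv, hdrr, hdt]
  have hp2q : (r ^ ((1 : ℝ) / 3)) ^ 2 * r ^ (-(2 : ℝ) / 3) = 1 := by
    rw [← Real.rpow_natCast, ← Real.rpow_mul hr.le, ← Real.rpow_add hr]
    norm_num
  have hp4 : r ^ ((4 : ℝ) / 3) = (r ^ ((1 : ℝ) / 3)) ^ 4 := by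
    rw [← Real.rpow_natCast, ← Real.rpow_mul hr.le]
    norm_num
  have hc3 : (t + 1) ^ (3 * α) = ((t + 1) ^ α) ^ 3 := by
    rw [← Real.rpow_natCast, ← Real.rpow_mul ht1.le, mul_comm]
    norm_num
  have hc1 : (t + 1) ^ (3 * α + 1) = ((t + 1) ^ α) ^ 3 * (t + 1) := by
    rw [Real.rpow_add_one ht1.ne', hc3]
  have hbound : b ^ 3 * (4 ^ 4 / 3 ^ 5) * (((t + 1) ^ α) ^ 3 * (t + 1)) ≤ α := by
    rw [← hc1]
    refine le_trans ?_ hb.le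
    gcongr
  have ha' : a * (3 * α + 1) = 4 ^ 3 * b ^ 3 / 3 ^ 5 := by
    rw [ha]
    field_simp
  rw [hp4, hc3, Real.rpow_sub_one ht1.ne']
  have hc : 0 < (t + 1) ^ α := Real.rpow_pos_of_pos ht1 α
  set c := (t + 1) ^ α
  set p := r ^ ((1 : ℝ) / 3)
  set q := r ^ (-(2 : ℝ) / 3)
  have key : (b * c * (4 / 3 * p)) ^ 2 * (b * c * (4 / 3 * (1 / 3 * q))) +
      (b * c * (4 / 3 * p)) ^ 4 -
        3 * (a * ((3 * α + 1) * c ^ 3) + b * (α * (c / (t + 1))) * p ^ 4) =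
      3 * b * c * p ^ 4 / (t + 1) * (b ^ 3 * (4 ^ 4 / 3 ^ 5) * (c ^ 3 * (t + 1)) - α) := by
    field_simp
    linear_combination (64 * b ^ 3 * c ^ 2 * (t + 1)) * hp2q - 243 * c ^ 2 * (t + 1) * ha'
  rw [key]
  exact mul_nonpos_of_nonneg_of_nonpos (by positivity) (by linarith)
end

section
/- Let n ≥ 2 and 2 ≤ p < ∞, and define K(r,t) = t^{−n/(p(p−1))} exp( −((p−1)/p^{p/(p−1)}) (r^p/t)^{1/(p−1)} ) for r > 0, t > 0. Then K solves Trudinger's equation in radial classical form: for every r > 0 and t > 0, |∂_r K|^{p−2} ( (p−1) ∂_{rr} K + ((n−1)/r) ∂_r K ) − (p−1) K^{p−2} ∂_t K = 0. Moreover K(r,t) → 0 as t → 0⁺ for each fixed r > 0, K(0,t) = t^{−n/(p(p−1))} → ∞ as t → 0⁺, and K(r,t) → 0 as r + t → ∞. -/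
open Set Filter

section TrudingerKernel

variable {p : ℝ}

/-- The similarity variable `(r ^ p / t) ^ (1 / (p - 1))` as a product of powers. -/
lemma similarity_eq_rpow_mul_rpow (hp : 2 ≤ p) {r t : ℝ} (hr : 0 ≤ r) (ht : 0 < t) :
    (r ^ p / t) ^ (1 / (p - 1)) = r ^ (1 + 1 / (p - 1)) * t ^ (-(1 / (p - 1))) := by
  have h1 : p - 1 ≠ 0 := by linarith
  have h2 : p * (1 / (p - 1)) = 1 + 1 / (p - 1) := by field_simp; ring
  rw [Real.div_rpow (Real.rpow_nonneg hr p) ht.le, ← Real.rpow_mul hr, h2, Real.rpow_neg ht.le,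
    div_eq_mul_inv]

/-- The coefficient in the exponent of the kernel, written with the exponent `-1 / (p - 1)`. -/
lemma kernel_coeff_eq (hp : 2 ≤ p) :
    (p - 1) / p ^ (p / (p - 1)) = (p - 1) / p * p ^ (-(1 / (p - 1))) := by
  have h1 : p - 1 ≠ 0 := by linarith
  have hp0 : 0 < p := by linarith
  have h2 : p / (p - 1) = 1 + 1 / (p - 1) := by field_simp; ring
  rw [h2, Real.rpow_add hp0, Real.rpow_one, Real.rpow_neg hp0.le, div_mul_eq_div_mul_one_div,
    one_div (p ^ (1 / (p - 1)))]

lemma div_mul_rpow_eq {r t : ℝ} (hp : 2 ≤ p) (hr : 0 < r) (ht : 0 < t) (q : ℝ) :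
    (r / (p * t)) ^ q = p ^ (-q) * r ^ q * t ^ (-q) := by
  have hp0 : 0 < p := by linarith
  rw [Real.div_rpow hr.le (by positivity), Real.mul_rpow hp0.le ht.le, Real.rpow_neg hp0.le,
    Real.rpow_neg ht.le]
  field_simp

/-- For positive arguments the exponent of the kernel is `(p - 1) / p * r * (r / (p t)) ^ q`. -/
lemma kernel_exponent_eq (hp : 2 ≤ p) {r t : ℝ} (hr : 0 < r) (ht : 0 < t) :
    -((p - 1) / p ^ (p / (p - 1))) * (r ^ p / t) ^ (1 / (p - 1)) =
      -((p - 1) / p * r * (r / (p * t)) ^ (1 / (p - 1))) := by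
  rw [similarity_eq_rpow_mul_rpow hp hr.le ht, kernel_coeff_eq hp, div_mul_rpow_eq hp hr ht,
    Real.rpow_add hr, Real.rpow_one]
  ring

lemma hasDerivAt_div_rpow_left (hp : 2 ≤ p) {r t : ℝ} (hr : 0 < r) (ht : 0 < t) (q : ℝ) :
    HasDerivAt (fun s => (s / (p * t)) ^ q) (q / r * (r / (p * t)) ^ q) r := by
  have hp0 : 0 < p := by linarith
  have hb : 0 < r / (p * t) := by positivity
  have h := ((hasDerivAt_id r).div_const (p * t)).rpow_const (p := q) (Or.inl hb.ne')
  refine h.congr_deriv ?_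
  symm
  change _ = 1 / (p * t) * q * (r / (p * t)) ^ (q - 1)
  rw [Real.rpow_sub_one hb.ne']
  field_simp

lemma hasDerivAt_div_rpow_right (hp : 2 ≤ p) {r t : ℝ} (hr : 0 < r) (ht : 0 < t) (q : ℝ) :
    HasDerivAt (fun s => (r / (p * s)) ^ q) (-(q / t) * (r / (p * t)) ^ q) t := by
  have hp0 : 0 < p := by linarith
  have hb : 0 < r / (p * t) := by positivity
  have h := (((hasDerivAt_const t r).div ((hasDerivAt_id t).const_mul p)
    (by simp only [id]; positivity))).rpow_const (p := q) (Or.inl hb.ne')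
  refine h.congr_deriv ?_
  symm
  change _ = (0 * (p * t) - r * (p * 1)) / (p * t) ^ 2 * q * (r / (p * t)) ^ (q - 1)
  rw [Real.rpow_sub_one hb.ne']
  field_simp
  ring

/-- The elementary bound `x ^ k * exp (-x) ≤ k ^ k`. -/
lemma rpow_mul_exp_neg_le {k x : ℝ} (hk : 0 < k) (hx : 0 ≤ x) :
    x ^ k * Real.exp (-x) ≤ k ^ k := by
  have h1 : x / k ≤ Real.exp (x / k) := by linarith [Real.add_one_le_exp (x / k)]
  have h2 := Real.rpow_le_rpow (by positivity) h1 hk.le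
  rw [Real.div_rpow hx hk.le, ← Real.exp_mul, div_mul_cancel₀ _ hk.ne',
    div_le_iff₀ (by positivity)] at h2
  rw [Real.exp_neg, ← div_eq_mul_inv, div_le_iff₀ (Real.exp_pos x), mul_comm]
  exact h2

/-- Decay of a self-similar profile in `r`, uniformly in `t`. -/
lemma rpow_mul_exp_le {a c m q r t : ℝ} (ha : 0 < a) (hc : 0 < c) (hq : 0 < q) (hr : 0 < r)
    (ht : 0 < t) :
    t ^ (-a) * Real.exp (-c * (r ^ m * t ^ (-q))) ≤
      (a / q) ^ (a / q) * c ^ (-(a / q)) * r ^ (-(m * (a / q))) := by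
  have h := rpow_mul_exp_neg_le (div_pos ha hq) (x := c * (r ^ m * t ^ (-q))) (by positivity)
  rw [Real.mul_rpow hc.le (by positivity), Real.mul_rpow (by positivity) (by positivity),
    ← Real.rpow_mul hr.le, ← Real.rpow_mul ht.le, neg_mul, mul_div_cancel₀ _ hq.ne'] at h
  rw [Real.rpow_neg hc.le, Real.rpow_neg hr.le, neg_mul, ← div_eq_mul_inv, ← div_eq_mul_inv,
    le_div_iff₀ (by positivity), le_div_iff₀ (by positivity)]
  linarith

lemma tendsto_rpow_mul_exp_zero {a b q : ℝ} (hb : 0 < b) (hq : 0 < q) :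
    Tendsto (fun t : ℝ => t ^ (-a) * Real.exp (-b * t ^ (-q))) (nhdsWithin 0 (Ioi 0))
      (nhds 0) := by
  have h := (tendsto_rpow_mul_exp_neg_mul_atTop_nhds_zero (a / q) b hb).comp
    (tendsto_rpow_neg_nhdsGT_zero (neg_lt_zero.mpr hq))
  refine h.congr' ?_
  filter_upwards [self_mem_nhdsWithin] with t ht
  have ht' : 0 < t := ht
  simp only [Function.comp]
  rw [← Real.rpow_mul ht'.le, neg_mul, mul_div_cancel₀ _ hq.ne']

end TrudingerKernel

/-- Remark 2.9: the kernel
`K(r,t) = t^{−n/(p(p−1))} exp(−((p−1)/p^{p/(p−1)})(r^p/t)^{1/(p−1)})` solves Trudinger's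
equation in radial form, with the stated boundary behaviour. -/
theorem stmt15 (n : ℕ) (hn : 2 ≤ n) (p : ℝ) (hp : 2 ≤ p)
    (K : ℝ → ℝ → ℝ)
    (hK : ∀ r t : ℝ, K r t = t ^ (-(n : ℝ) / (p * (p - 1))) *
      Real.exp (-((p - 1) / p ^ (p / (p - 1))) * (r ^ p / t) ^ (1 / (p - 1)))) :
    (∀ r t : ℝ, 0 < r → 0 < t →
      |deriv (fun s => K s t) r| ^ (p - 2) *
          ((p - 1) * deriv (deriv fun s => K s t) r +
            ((n : ℝ) - 1) / r * deriv (fun s => K s t) r) -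
        (p - 1) * K r t ^ (p - 2) * deriv (fun s => K r s) t = 0) ∧
    (∀ r : ℝ, 0 < r →
      Filter.Tendsto (fun t => K r t) (nhdsWithin 0 (Set.Ioi 0)) (nhds 0)) ∧
    (∀ t : ℝ, 0 < t → K 0 t = t ^ (-(n : ℝ) / (p * (p - 1)))) ∧
    Filter.Tendsto (fun t => K 0 t) (nhdsWithin 0 (Set.Ioi 0)) Filter.atTop ∧
    (∀ ε > (0 : ℝ), ∃ M : ℝ, ∀ r t : ℝ, 0 ≤ r → 0 < t → M ≤ r + t → K r t ≤ ε) := by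
  have hp0 : 0 < p := by linarith
  have hp1 : 0 < p - 1 := by linarith
  have hn0 : (0 : ℝ) < n := by exact_mod_cast (by omega : 0 < n)
  set q : ℝ := 1 / (p - 1) with hq
  have hq0 : 0 < q := by positivity
  set a : ℝ := (n : ℝ) / (p * (p - 1)) with ha
  have ha0 : 0 < a := by positivity
  have hna : -(n : ℝ) / (p * (p - 1)) = -a := neg_div _ _
  set c : ℝ := (p - 1) / p ^ (p / (p - 1)) with hc
  have hc0 : 0 < c := by positivity
  have hK1 : ∀ r t : ℝ, 0 ≤ r → 0 < t →
      K r t = t ^ (-a) * Real.exp (-c * (r ^ (1 + q) * t ^ (-q))) := by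
    intro r t hr ht
    rw [hK, similarity_eq_rpow_mul_rpow hp hr ht, hna]
  have hK2 : ∀ r t : ℝ, 0 < r → 0 < t →
      K r t = t ^ (-a) * Real.exp (-((p - 1) / p * r * (r / (p * t)) ^ q)) := by
    intro r t hr ht
    rw [hK, hc, hq, kernel_exponent_eq hp hr ht, hna]
  have hK0 : ∀ t : ℝ, 0 < t → K 0 t = t ^ (-a) := by
    intro t ht
    rw [hK1 0 t le_rfl ht, Real.zero_rpow (by positivity)]
    simp
  have hqp : q * (p - 1) = 1 := by rw [hq]; field_simp
  have hdr : ∀ r t : ℝ, 0 < r → 0 < t →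
      HasDerivAt (fun s => K s t) (-(r / (p * t)) ^ q * K r t) r := by
    intro r t hr ht
    have h := ((((hasDerivAt_id r).const_mul ((p - 1) / p)).mul
      (hasDerivAt_div_rpow_left hp hr ht q)).neg.exp).const_mul (t ^ (-a))
    have h' : HasDerivAt (fun s => K s t) _ r := h.congr_of_eventuallyEq (by
      filter_upwards [lt_mem_nhds hr] with s hs
      exact hK2 s t hs ht)
    convert h' using 1
    rw [hK2 r t hr ht]
    simp only [id, Pi.mul_apply, Pi.neg_apply, mul_one]
    have : (p - 1) / p * (r / (p * t)) ^ q + (p - 1) / p * r * (q / r * (r / (p * t)) ^ q) =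
        (r / (p * t)) ^ q := by
      have h3 : (p - 1) / p * r * (q / r * (r / (p * t)) ^ q) =
          (q * (p - 1)) / p * (r / (p * t)) ^ q := by field_simp
      rw [h3, hqp]
      field_simp
      ring
    rw [this]
    ring
  have hdt : ∀ r t : ℝ, 0 < r → 0 < t →
      HasDerivAt (fun s => K r s) ((-(a / t) + r / (p * t) * (r / (p * t)) ^ q) * K r t) t := by
    intro r t hr ht
    have h := ((hasDerivAt_id t).rpow_const (p := -a) (Or.inl ht.ne')).mul
      ((hasDerivAt_div_rpow_right hp hr ht q).const_mul ((p - 1) / p * r)).neg.exp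
    have h' : HasDerivAt (fun s => K r s) _ t := h.congr_of_eventuallyEq (by
      filter_upwards [lt_mem_nhds ht] with s hs
      exact hK2 r s hr hs)
    convert h' using 1
    rw [hK2 r t hr ht]
    simp only [id, Pi.neg_apply, one_mul]
    have : (p - 1) / p * r * (-(q / t) * (r / (p * t)) ^ q) =
        -(r / (p * t) * (r / (p * t)) ^ q) := by
      have h3 : (p - 1) / p * r * (-(q / t) * (r / (p * t)) ^ q) =
          -((q * (p - 1)) * r / (p * t) * (r / (p * t)) ^ q) := by field_simp
      rw [h3, hqp, one_mul]
    rw [this, Real.rpow_sub_one ht.ne']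
    ring
  refine ⟨?_, ?_, ?_, ?_, ?_⟩
  · intro r t hr ht
    have hKpos : 0 < K r t := by rw [hK2 r t hr ht]; positivity
    have hb : 0 < r / (p * t) := by positivity
    have hd2 : deriv (deriv fun s => K s t) r =
        (-(q / r * (r / (p * t)) ^ q) + ((r / (p * t)) ^ q) ^ 2) * K r t := by
      have he : (deriv fun s => K s t) =ᶠ[nhds r] fun s => -(s / (p * t)) ^ q * K s t := by
        filter_upwards [lt_mem_nhds hr] with s hs
        exact (hdr s t hs ht).deriv
      rw [he.deriv_eq]
      refine (((hasDerivAt_div_rpow_left hp hr ht q).neg.mul (hdr r t hr ht)).deriv).trans ?_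
      simp only [Pi.neg_apply]
      ring
    have hu : ((r / (p * t)) ^ q) ^ (p - 2) * (r / (p * t)) ^ q = r / (p * t) := by
      rw [← Real.rpow_mul hb.le, ← Real.rpow_add hb,
        show q * (p - 2) + q = q * (p - 1) by ring, hqp, Real.rpow_one]
    rw [hd2, (hdr r t hr ht).deriv, (hdt r t hr ht).deriv, abs_mul, abs_neg,
      abs_of_pos (Real.rpow_pos_of_pos hb q), abs_of_pos hKpos,
      Real.mul_rpow (Real.rpow_nonneg hb.le q) hKpos.le]
    have hat : (p - 1) * (a / t) = n / r * (r / (p * t)) := by rw [ha]; field_simp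
    set u := (r / (p * t)) ^ q
    linear_combination (K r t ^ (p - 2) * K r t) *
      (((p - 1) * u - n / r) * hu + hat - u ^ (p - 2) * u / r * hqp)
  · intro r hr
    have h := tendsto_rpow_mul_exp_zero (a := a) (mul_pos hc0 (Real.rpow_pos_of_pos hr (1 + q))) hq0
    refine h.congr' ?_
    filter_upwards [self_mem_nhdsWithin] with t ht
    rw [hK1 r t hr.le ht]
    ring_nf
  · intro t ht
    rw [hK0 t ht, hna]
  · refine (tendsto_rpow_neg_nhdsGT_zero (neg_lt_zero.mpr ha0)).congr' ?_
    filter_upwards [self_mem_nhdsWithin] with t ht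
    exact (hK0 t ht).symm
  · intro ε hε
    have hk : 0 < (1 + q) * (a / q) := by positivity
    have h1 := (tendsto_rpow_neg_atTop ha0).eventually_le_const hε
    have h2 := ((tendsto_rpow_neg_atTop hk).const_mul
      ((a / q) ^ (a / q) * c ^ (-(a / q)))).eventually_le_const (by simpa using hε)
    obtain ⟨M, hM⟩ := eventually_atTop.mp (h1.and (h2.and (eventually_gt_atTop 0)))
    refine ⟨2 * M, fun r t hr ht hrt => ?_⟩
    rw [hK1 r t hr ht]
    rcases le_total M t with h | h
    · refine le_trans ?_ (hM t h).1
      refine mul_le_of_le_one_right (by positivity) (Real.exp_le_one_iff.mpr ?_)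
      rw [neg_mul]
      exact neg_nonpos.mpr (by positivity)
    · have hr' := (hM r (by linarith)).2
      exact (rpow_mul_exp_le ha0 hc0 hq0 hr'.2 ht).trans hr'.1
end

section
/- Let 2 ≤ p < ∞ and let Ω ⊂ ℝⁿ (n ≥ 2) be a bounded domain. Set Ω_∞ = Ω×(0,∞) with parabolic boundary P_∞, and let h ∈ C(P_∞) with 0 < inf_{P_∞} h ≤ sup_{P_∞} h < ∞. Suppose that for every T > 0 the problem Γ_p v = 0 in Ω_T, v = h on P_T, has a unique positive viscosity solution. Then the problem Γ_p v = 0 in Ω_∞, v = h on P_∞, has a unique positive viscosity solution u ∈ C(Ω_∞ ∪ P_∞), and moreover inf_{P_∞} h ≤ u ≤ sup_{P_∞} h. -/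
open Set Filter
open scoped Classical

open scoped Topology

theorem pcyl_union_pbdry_mono {n : ℕ} {Ω : Set (EuclideanSpace ℝ (Fin n))} {I J : Set ℝ}
    (hIJ : I ⊆ J) : pcyl n Ω I ∪ pbdry n Ω I ⊆ pcyl n Ω J ∪ pbdry n Ω J :=
  union_subset_union (prod_mono_right hIJ)
    (union_subset_union_right _ (prod_mono_right hIJ))

theorem mem_pcyl_union_pbdry_Ioi {n : ℕ} {Ω : Set (EuclideanSpace ℝ (Fin n))}
    {q : EuclideanSpace ℝ (Fin n) × ℝ} :
    q ∈ pcyl n Ω (Ioi 0) ∪ pbdry n Ω (Ioi 0) ↔ q.1 ∈ closure Ω ∧ 0 ≤ q.2 := by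
  simp only [pcyl, pbdry, mem_union, mem_prod, mem_Ioi, mem_singleton_iff,
    closure_eq_self_union_frontier]
  constructor
  · rintro (⟨h1, h2⟩ | ⟨h1, h2⟩ | ⟨h1, h2⟩)
    · exact ⟨.inl h1, h2.le⟩
    · exact ⟨h1, h2.ge⟩
    · exact ⟨.inr h1, h2.le⟩
  · rintro ⟨h1, h2⟩
    rcases h2.eq_or_lt with h2 | h2
    · exact .inr (.inl ⟨h1, h2.symm⟩)
    · exact h1.elim (fun h => .inl ⟨h, h2⟩) (fun h => .inr (.inr ⟨h, h2⟩))

theorem mem_pcyl_union_pbdry_Ioo {n : ℕ} {Ω : Set (EuclideanSpace ℝ (Fin n))}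
    {q : EuclideanSpace ℝ (Fin n) × ℝ} {T : ℝ}
    (hq : q ∈ pcyl n Ω (Ioi 0) ∪ pbdry n Ω (Ioi 0)) (hT : q.2 < T) :
    q ∈ pcyl n Ω (Ioo 0 T) ∪ pbdry n Ω (Ioo 0 T) := by
  rcases hq with ⟨h1, h2⟩ | ⟨h1, h2⟩ | ⟨h1, h2⟩
  · exact .inl ⟨h1, h2, hT⟩
  · exact .inr (.inl ⟨h1, h2⟩)
  · exact .inr (.inr ⟨h1, h2, hT⟩)

theorem lt_of_mem_pcyl_union_pbdry_Ioo {n : ℕ} {Ω : Set (EuclideanSpace ℝ (Fin n))}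
    {q : EuclideanSpace ℝ (Fin n) × ℝ} {T : ℝ} (hT : 0 < T)
    (hq : q ∈ pcyl n Ω (Ioo 0 T) ∪ pbdry n Ω (Ioo 0 T)) : q.2 < T := by
  rcases hq with ⟨h1, h2⟩ | ⟨h1, h2⟩ | ⟨h1, h2⟩
  · exact h2.2
  · exact (mem_singleton_iff.1 h2).trans_lt hT
  · exact h2.2

theorem TrudSub.mono {n : ℕ} {p : ℝ} {U V : Set (EuclideanSpace ℝ (Fin n) × ℝ)}
    {u : EuclideanSpace ℝ (Fin n) × ℝ → ℝ} (hu : TrudSub n p U u) (hV : IsOpen V)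
    (hVU : V ⊆ U) : TrudSub n p V u := fun ψ hψ q hq hmax =>
  hu ψ hψ q (hVU hq) ((hmax.isLocalMax (hV.mem_nhds hq)).on U)

theorem TrudSuper.mono {n : ℕ} {p : ℝ} {U V : Set (EuclideanSpace ℝ (Fin n) × ℝ)}
    {u : EuclideanSpace ℝ (Fin n) × ℝ → ℝ} (hu : TrudSuper n p U u) (hV : IsOpen V)
    (hVU : V ⊆ U) : TrudSuper n p V u := fun ψ hψ q hq hmin =>
  hu ψ hψ q (hVU hq) ((hmin.isLocalMin (hV.mem_nhds hq)).on U)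

theorem TrudSub.of_local {n : ℕ} {p : ℝ} {U : Set (EuclideanSpace ℝ (Fin n) × ℝ)}
    {u : EuclideanSpace ℝ (Fin n) × ℝ → ℝ}
    (H : ∀ q ∈ U, ∃ V ⊆ U, ∃ v, q ∈ V ∧ EqOn u v V ∧ TrudSub n p V v) : TrudSub n p U u := by
  intro ψ hψ q hq hmax
  obtain ⟨V, hVU, v, hqV, huv, hv⟩ := H q hq
  rw [huv hqV]
  refine hv ψ hψ q hqV ((hmax.on_subset hVU).congr ?_ hqV)
  filter_upwards [self_mem_nhdsWithin] with z hz
  rw [huv hz]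

theorem TrudSuper.of_local {n : ℕ} {p : ℝ} {U : Set (EuclideanSpace ℝ (Fin n) × ℝ)}
    {u : EuclideanSpace ℝ (Fin n) × ℝ → ℝ}
    (H : ∀ q ∈ U, ∃ V ⊆ U, ∃ v, q ∈ V ∧ EqOn u v V ∧ TrudSuper n p V v) :
    TrudSuper n p U u := by
  intro ψ hψ q hq hmin
  obtain ⟨V, hVU, v, hqV, huv, hv⟩ := H q hq
  rw [huv hqV]
  refine hv ψ hψ q hqV ((hmin.on_subset hVU).congr ?_ hqV)
  filter_upwards [self_mem_nhdsWithin] with z hz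
  rw [huv hz]

theorem TrudBVPSol.mono {n : ℕ} {p : ℝ} {Ω : Set (EuclideanSpace ℝ (Fin n))} {I J : Set ℝ}
    {h u : EuclideanSpace ℝ (Fin n) × ℝ → ℝ} (hu : TrudBVPSol n p Ω J h u) (hΩ : IsOpen Ω)
    (hI : IsOpen I) (hIJ : I ⊆ J) : TrudBVPSol n p Ω I h u := by
  obtain ⟨hc, hpos, hsub, hsup, hb⟩ := hu
  have hcyl : pcyl n Ω I ⊆ pcyl n Ω J := prod_mono_right hIJ
  exact ⟨hc.mono (pcyl_union_pbdry_mono hIJ), fun q hq => hpos q (pcyl_union_pbdry_mono hIJ hq),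
    hsub.mono (hΩ.prod hI) hcyl, hsup.mono (hΩ.prod hI) hcyl,
    fun q hq => hb q (union_subset_union_right _ (prod_mono_right hIJ) hq)⟩

/-- A function that agrees on each finite cylinder with a solution there is a global solution. -/
theorem TrudBVPSol.of_forall_Ioo {n : ℕ} {p : ℝ} {Ω : Set (EuclideanSpace ℝ (Fin n))}
    {h u : EuclideanSpace ℝ (Fin n) × ℝ → ℝ} {U : ℝ → EuclideanSpace ℝ (Fin n) × ℝ → ℝ}
    (hU : ∀ T > 0, TrudBVPSol n p Ω (Ioo 0 T) h (U T))
    (huU : ∀ T > 0, EqOn u (U T) (pcyl n Ω (Ioo 0 T) ∪ pbdry n Ω (Ioo 0 T))) :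
    TrudBVPSol n p Ω (Ioi 0) h u := by
  have hpos : ∀ q ∈ pcyl n Ω (Ioi 0) ∪ pbdry n Ω (Ioi 0), 0 < q.2 + 1 := fun q hq => by
    linarith [(mem_pcyl_union_pbdry_Ioi.1 hq).2]
  have hmem : ∀ q ∈ pcyl n Ω (Ioi 0) ∪ pbdry n Ω (Ioi 0),
      q ∈ pcyl n Ω (Ioo 0 (q.2 + 1)) ∪ pbdry n Ω (Ioo 0 (q.2 + 1)) := fun q hq =>
    mem_pcyl_union_pbdry_Ioo hq (lt_add_one _)
  have hcyl : ∀ T, pcyl n Ω (Ioo 0 T) ⊆ pcyl n Ω (Ioi 0) := fun T =>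
    prod_mono_right Ioo_subset_Ioi_self
  refine ⟨fun q hq => ?_, fun q hq => ?_, .of_local fun q hq => ?_, .of_local fun q hq => ?_,
    fun q hq => ?_⟩
  · have hc := ((hU _ (hpos q hq)).1.congr (huU _ (hpos q hq))) q (hmem q hq)
    refine hc.mono_of_mem_nhdsWithin ?_
    have hlt : ∀ᶠ z : EuclideanSpace ℝ (Fin n) × ℝ in 𝓝 q, z.2 < q.2 + 1 :=
      continuous_snd.continuousAt.eventually_lt continuousAt_const (lt_add_one _)
    filter_upwards [self_mem_nhdsWithin, mem_nhdsWithin_of_mem_nhds hlt] with z hz hz'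
    exact mem_pcyl_union_pbdry_Ioo hz hz'
  · rw [huU _ (hpos q hq) (hmem q hq)]
    exact (hU _ (hpos q hq)).2.1 q (hmem q hq)
  · have h0 := hpos q (.inl hq)
    exact ⟨_, hcyl (q.2 + 1), U (q.2 + 1), ⟨hq.1, hq.2, lt_add_one _⟩,
      (huU _ h0).mono subset_union_left, (hU _ h0).2.2.1⟩
  · have h0 := hpos q (.inl hq)
    exact ⟨_, hcyl (q.2 + 1), U (q.2 + 1), ⟨hq.1, hq.2, lt_add_one _⟩,
      (huU _ h0).mono subset_union_left, (hU _ h0).2.2.2.1⟩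
  · have h0 := hpos q (.inr hq)
    have hq' : q ∈ pbdry n Ω (Ioo 0 (q.2 + 1)) :=
      hq.imp id fun hq => ⟨hq.1, hq.2, lt_add_one _⟩
    rw [huU _ h0 (.inr hq')]
    exact (hU _ h0).2.2.2.2 q hq'

theorem pSpaceLap_of_time {n : ℕ} (p : ℝ) (g : ℝ → ℝ) (q : EuclideanSpace ℝ (Fin n) × ℝ) :
    pSpaceLap n p (fun z => g z.2) q = 0 := by
  simp [pSpaceLap, pLap, gradient, iteratedFDeriv_const_of_ne]

theorem paraTestFn_of_time {n : ℕ} {g : ℝ → ℝ} (hg : ContDiff ℝ 1 g) :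
    ParaTestFn n (fun z => g z.2) :=
  ⟨fun t => contDiff_const (c := g t), fun _ => hg⟩

/-- If a function continuous up to the parabolic boundary exceeds somewhere its bound on the
parabolic boundary, then subtracting some strictly increasing function of time produces an
interior maximum. -/
theorem exists_isLocalMax_sub_time {n : ℕ} {Ω : Set (EuclideanSpace ℝ (Fin n))}
    (hΩ : IsOpen Ω) (hΩb : Bornology.IsBounded Ω) {v : EuclideanSpace ℝ (Fin n) × ℝ → ℝ}
    (hv : ContinuousOn v (pcyl n Ω (Ioi 0) ∪ pbdry n Ω (Ioi 0))) {M : ℝ}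
    (hM : ∀ q ∈ pbdry n Ω (Ioi 0), v q ≤ M) {q₀ : EuclideanSpace ℝ (Fin n) × ℝ}
    (hq₀ : q₀ ∈ pcyl n Ω (Ioi 0) ∪ pbdry n Ω (Ioi 0)) (hlt : M < v q₀) :
    ∃ g : ℝ → ℝ, ContDiff ℝ 1 g ∧ (∀ t, 0 < deriv g t) ∧
      ∃ q ∈ pcyl n Ω (Ioi 0), IsLocalMax (fun z => v z - g z.2) q := by
  obtain ⟨hx₀, ht₀⟩ := mem_pcyl_union_pbdry_Ioi.1 hq₀
  set K : Set (EuclideanSpace ℝ (Fin n) × ℝ) := closure Ω ×ˢ Icc 0 (q₀.2 + 1) with hK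
  have hKc : IsCompact K := hΩb.isCompact_closure.prod isCompact_Icc
  have hKs : K ⊆ pcyl n Ω (Ioi 0) ∪ pbdry n Ω (Ioi 0) := fun z hz =>
    mem_pcyl_union_pbdry_Ioi.2 ⟨hz.1, hz.2.1⟩
  have hq₀K : q₀ ∈ K := ⟨hx₀, ht₀, by linarith⟩
  obtain ⟨B, hB⟩ := (hKc.image_of_continuousOn (hv.mono hKs)).bddAbove
  set ε := (v q₀ - M) / 2 with hε
  have hε0 : 0 < ε := by rw [hε]; linarith
  obtain ⟨k, hk, hk0⟩ : ∃ k : ℝ, (B - M) / ε < Real.exp k ∧ 0 < k :=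
    ((Real.tendsto_exp_atTop.eventually_gt_atTop _).and (eventually_gt_atTop 0)).exists
  rw [div_lt_iff₀ hε0] at hk
  have hd : ∀ t, HasDerivAt (fun t => ε * Real.exp (k * (t - q₀.2)))
      (ε * (Real.exp (k * (t - q₀.2)) * (k * 1))) t := fun t =>
    ((((hasDerivAt_id t).sub_const _).const_mul k).exp).const_mul ε
  refine ⟨fun t => ε * Real.exp (k * (t - q₀.2)), by fun_prop, fun t => ?_, ?_⟩
  · rw [(hd t).deriv]
    positivity
  have hgc : Continuous fun z : EuclideanSpace ℝ (Fin n) × ℝ =>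
      ε * Real.exp (k * (z.2 - q₀.2)) := by fun_prop
  obtain ⟨q, hqK, hq⟩ := hKc.exists_isMaxOn ⟨q₀, hq₀K⟩ ((hv.mono hKs).sub hgc.continuousOn)
  have hval : M < v q - ε * Real.exp (k * (q.2 - q₀.2)) := by
    have h1 : v q₀ - ε * Real.exp (k * (q₀.2 - q₀.2)) ≤
        v q - ε * Real.exp (k * (q.2 - q₀.2)) := hq hq₀K
    simp only [sub_self, mul_zero, Real.exp_zero, mul_one] at h1
    linarith
  have hqnb : q ∉ pbdry n Ω (Ioi 0) := fun hb => by
    have h1 := hM q hb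
    have h2 : 0 < ε * Real.exp (k * (q.2 - q₀.2)) := by positivity
    linarith
  have hqc : q ∈ pcyl n Ω (Ioi 0) := (hKs hqK).resolve_right hqnb
  have hqT : q.2 < q₀.2 + 1 := by
    refine hqK.2.2.lt_of_ne fun heq => ?_
    have h1 : v q ≤ B := hB (mem_image_of_mem v hqK)
    rw [heq, add_sub_cancel_left, mul_one] at hval
    linarith
  refine ⟨q, hqc, hq.isLocalMax ?_⟩
  exact prod_mem_nhds (mem_of_superset (hΩ.mem_nhds hqc.1) subset_closure)
    (Icc_mem_nhds hqc.2 hqT)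

theorem TrudBVPSol.le_of_boundary_le {n : ℕ} {p : ℝ} (hp : 1 < p)
    {Ω : Set (EuclideanSpace ℝ (Fin n))} (hΩ : IsOpen Ω) (hΩb : Bornology.IsBounded Ω)
    {h u : EuclideanSpace ℝ (Fin n) × ℝ → ℝ} (hu : TrudBVPSol n p Ω (Ioi 0) h u) {M : ℝ}
    (hM : ∀ q ∈ pbdry n Ω (Ioi 0), h q ≤ M) :
    ∀ q ∈ pcyl n Ω (Ioi 0) ∪ pbdry n Ω (Ioi 0), u q ≤ M := by
  intro q₀ hq₀
  by_contra! hlt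
  obtain ⟨hc, hpos, hsub, -, hb⟩ := hu
  obtain ⟨g, hg, hg', q, hq, hmax⟩ := exists_isLocalMax_sub_time hΩ hΩb hc
    (fun q hq => (hb q hq).trans_le (hM q hq)) hq₀ hlt
  have h1 := hsub _ (paraTestFn_of_time hg) q hq (hmax.on _)
  rw [pSpaceLap_of_time] at h1
  have h2 : 0 < (p - 1) * u q ^ (p - 2) * deriv g q.2 :=
    mul_pos (mul_pos (by linarith) (Real.rpow_pos_of_pos (hpos q (.inl hq)) _)) (hg' _)
  simp only [timeDeriv] at h1
  linarith

theorem TrudBVPSol.le_of_le_boundary {n : ℕ} {p : ℝ} (hp : 1 < p)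
    {Ω : Set (EuclideanSpace ℝ (Fin n))} (hΩ : IsOpen Ω) (hΩb : Bornology.IsBounded Ω)
    {h u : EuclideanSpace ℝ (Fin n) × ℝ → ℝ} (hu : TrudBVPSol n p Ω (Ioi 0) h u) {m : ℝ}
    (hm : ∀ q ∈ pbdry n Ω (Ioi 0), m ≤ h q) :
    ∀ q ∈ pcyl n Ω (Ioi 0) ∪ pbdry n Ω (Ioi 0), m ≤ u q := by
  intro q₀ hq₀
  by_contra! hlt
  obtain ⟨hc, hpos, -, hsup, hb⟩ := hu
  obtain ⟨g, hg, hg', q, hq, hmax⟩ := exists_isLocalMax_sub_time (v := fun z => -u z) (M := -m)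
    hΩ hΩb hc.neg (fun q hq => neg_le_neg ((hm q hq).trans_eq (hb q hq).symm)) hq₀
    (neg_lt_neg hlt)
  have hmin : IsLocalMin (fun z => u z - -g z.2) q := by
    filter_upwards [hmax] with z hz
    linarith
  have h1 := hsup _ (paraTestFn_of_time (g := fun t => -g t) hg.neg) q hq (hmin.on _)
  rw [pSpaceLap_of_time p fun t => -g t] at h1
  have h2 : 0 < (p - 1) * u q ^ (p - 2) * deriv g q.2 :=
    mul_pos (mul_pos (by linarith) (Real.rpow_pos_of_pos (hpos q (.inl hq)) _)) (hg' _)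
  simp only [timeDeriv, deriv.fun_neg, mul_neg] at h1
  linarith

/-- Lemma 2.8: if the boundary value problem for Trudinger's equation has a unique positive
solution on every finite cylinder `Ω × (0,T)`, then it has a unique positive solution on
`Ω × (0,∞)`, which moreover is trapped between `inf h` and `sup h`. -/
theorem stmt16 (n : ℕ) (hn : 2 ≤ n) (p : ℝ) (hp : 2 ≤ p)
    (Ω : Set (EuclideanSpace ℝ (Fin n))) (hΩo : IsOpen Ω) (hΩc : IsConnected Ω)
    (hΩb : Bornology.IsBounded Ω)
    (h : EuclideanSpace ℝ (Fin n) × ℝ → ℝ)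
    (hh : ContinuousOn h (pbdry n Ω (Set.Ioi 0)))
    (hhi : 0 < sInf (h '' pbdry n Ω (Set.Ioi 0)))
    (hhs : BddAbove (h '' pbdry n Ω (Set.Ioi 0)))
    (hex : ∀ T > (0 : ℝ), ∃ u, TrudBVPSol n p Ω (Set.Ioo 0 T) h u)
    (huniq : ∀ T > (0 : ℝ), ∀ u v, TrudBVPSol n p Ω (Set.Ioo 0 T) h u →
      TrudBVPSol n p Ω (Set.Ioo 0 T) h v →
      Set.EqOn u v (pcyl n Ω (Set.Ioo 0 T) ∪ pbdry n Ω (Set.Ioo 0 T))) :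
    (∃ u, TrudBVPSol n p Ω (Set.Ioi 0) h u ∧
      ∀ q ∈ pcyl n Ω (Set.Ioi 0) ∪ pbdry n Ω (Set.Ioi 0),
        sInf (h '' pbdry n Ω (Set.Ioi 0)) ≤ u q ∧
          u q ≤ sSup (h '' pbdry n Ω (Set.Ioi 0))) ∧
    ∀ u v, TrudBVPSol n p Ω (Set.Ioi 0) h u → TrudBVPSol n p Ω (Set.Ioi 0) h v →
      Set.EqOn u v (pcyl n Ω (Set.Ioi 0) ∪ pbdry n Ω (Set.Ioi 0)) := by
  have hBddBelow : BddBelow (h '' pbdry n Ω (Ioi 0)) := by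
    by_contra hb
    exact hhi.ne' (Real.sInf_of_not_bddBelow hb)
  have hp1 : 1 < p := by linarith
  refine ⟨?_, fun u v hu hv q hq => ?_⟩
  · have hex' : ∀ T : ℝ, ∃ u, 0 < T → TrudBVPSol n p Ω (Ioo 0 T) h u := fun T => by
      by_cases hT : 0 < T
      · exact (hex T hT).imp fun u hu _ => hu
      · exact ⟨h, fun h' => absurd h' hT⟩
    choose U hU using hex'
    have hglue : ∀ T > 0, EqOn (fun q => U (q.2 + 1) q) (U T)
        (pcyl n Ω (Ioo 0 T) ∪ pbdry n Ω (Ioo 0 T)) := by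
      intro T hT q hq
      have hq' := pcyl_union_pbdry_mono Ioo_subset_Ioi_self hq
      have h0 : 0 < q.2 + 1 := by linarith [(mem_pcyl_union_pbdry_Ioi.1 hq').2]
      exact huniq (min (q.2 + 1) T) (lt_min h0 hT) _ _
        ((hU _ h0).mono hΩo isOpen_Ioo (Ioo_subset_Ioo_right (min_le_left _ _)))
        ((hU _ hT).mono hΩo isOpen_Ioo (Ioo_subset_Ioo_right (min_le_right _ _)))
        (mem_pcyl_union_pbdry_Ioo hq'
          (lt_min (lt_add_one _) (lt_of_mem_pcyl_union_pbdry_Ioo hT hq)))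
    have hu := TrudBVPSol.of_forall_Ioo hU hglue
    exact ⟨_, hu, fun q hq =>
      ⟨hu.le_of_le_boundary hp1 hΩo hΩb
          (fun z hz => csInf_le hBddBelow (mem_image_of_mem h hz)) q hq,
        hu.le_of_boundary_le hp1 hΩo hΩb
          (fun z hz => le_csSup hhs (mem_image_of_mem h hz)) q hq⟩⟩
  · have h0 : 0 < q.2 + 1 := by linarith [(mem_pcyl_union_pbdry_Ioi.1 hq).2]
    exact huniq (q.2 + 1) h0 u v (hu.mono hΩo isOpen_Ioo Ioo_subset_Ioi_self)
      (hv.mono hΩo isOpen_Ioo Ioo_subset_Ioi_self)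
      (mem_pcyl_union_pbdry_Ioo hq (lt_add_one _))
end
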